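/- arXiv:1401.6556 — 8 statements merged into one kernel-verified Lean document; each statement's English description precedes it below -/
import Mathlib

section
/- For every a > 0, b > 0, w > 0 and δ > 0, with ĥ_δ(x,y) = δ + x²/a + y²/b one has the pointwise bound ((2x/a)² + (2y/b)²)/ĥ_δ(x,y) ≤ 4·max(1/a, 1/b) for all (x,y), and consequently ∫_{E_w} ‖∇ĥ_δ(x,y)‖²/(3·ĥ_δ(x,y)) dx dy ≤ (4/3)·max(1/a, 1/b)·π·√(a·b)·w², where E_w = {(x,y) ∈ ℝ² : x²/a + y²/b ≤ w²}; in particular this integral is bounded uniformly in δ > 0. -/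
open MeasureTheory Real

lemma ellipse_vol (a b w : ℝ) (ha : 0 < a) (hb : 0 < b) (hw : 0 < w) :
    volume {p : ℝ × ℝ | p.1 ^ 2 / a + p.2 ^ 2 / b ≤ w ^ 2} =
      ENNReal.ofReal (Real.pi * Real.sqrt (a * b) * w ^ 2) := by
  have hD : volume {p : ℝ × ℝ | p.1 ^ 2 + p.2 ^ 2 ≤ w ^ 2} = ENNReal.ofReal (π * w ^ 2) := by
    have hm : MeasurableSet {p : ℝ × ℝ | p.1 ^ 2 + p.2 ^ 2 ≤ w ^ 2} :=
      measurableSet_le (by fun_prop) (by fun_prop)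
    rw [← Complex.volume_preserving_equiv_real_prod.measure_preimage hm.nullMeasurableSet]
    have : (Complex.measurableEquivRealProd ⁻¹' {p : ℝ × ℝ | p.1 ^ 2 + p.2 ^ 2 ≤ w ^ 2})
        = Metric.closedBall (0 : ℂ) w := by
      ext z
      simp only [Set.mem_preimage, Set.mem_setOf_eq, Complex.measurableEquivRealProd_apply,
        mem_closedBall_zero_iff]
      rw [← sq_le_sq₀ (norm_nonneg z) hw.le, Complex.sq_norm, Complex.normSq_apply]
      simp only [sq]
    rw [this, Complex.volume_closedBall, mul_comm π, ENNReal.ofReal_mul (by positivity),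
      ENNReal.ofReal_pow hw.le]
    congr 1
    rw [← NNReal.coe_real_pi, ENNReal.ofReal_coe_nnreal]
  have hsa := Real.sqrt_pos.2 ha
  have hsb := Real.sqrt_pos.2 hb
  let f : (ℝ × ℝ) →ₗ[ℝ] (ℝ × ℝ) :=
    LinearMap.prodMap ((√a)⁻¹ • LinearMap.id) ((√b)⁻¹ • LinearMap.id)
  have hf : LinearMap.det f = (√a)⁻¹ * (√b)⁻¹ := by
    simp [f, LinearMap.det_prodMap]
  have := Measure.addHaar_preimage_linearMap (volume : Measure (ℝ × ℝ)) (f := f)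
    (by rw [hf]; positivity) {p : ℝ × ℝ | p.1 ^ 2 + p.2 ^ 2 ≤ w ^ 2}
  rw [hD, hf, ← ENNReal.ofReal_mul (by positivity)] at this
  convert this using 2
  · ext p
    simp [f, mul_pow, Real.sq_sqrt ha.le, Real.sq_sqrt hb.le]
    simp only [div_eq_inv_mul]
  · rw [abs_of_pos (by positivity), Real.sqrt_mul ha.le]
    field_simp

theorem bound_gap_3d (a b w δ : ℝ) (ha : 0 < a) (hb : 0 < b) (hw : 0 < w) (hδ : 0 < δ) :
    (∀ x y : ℝ,
        ((2 * x / a) ^ 2 + (2 * y / b) ^ 2) / (δ + x ^ 2 / a + y ^ 2 / b) ≤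
          4 * max (1 / a) (1 / b)) ∧
      ∫ p in {p : ℝ × ℝ | p.1 ^ 2 / a + p.2 ^ 2 / b ≤ w ^ 2},
          ((2 * p.1 / a) ^ 2 + (2 * p.2 / b) ^ 2) /
            (3 * (δ + p.1 ^ 2 / a + p.2 ^ 2 / b)) ≤
        4 / 3 * max (1 / a) (1 / b) * Real.pi * Real.sqrt (a * b) * w ^ 2 := by
  have key : ∀ x y : ℝ,
        ((2 * x / a) ^ 2 + (2 * y / b) ^ 2) / (δ + x ^ 2 / a + y ^ 2 / b) ≤
          4 * max (1 / a) (1 / b) := by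
    intro x y
    have hx : 0 ≤ x ^ 2 / a := by positivity
    have hy : 0 ≤ y ^ 2 / b := by positivity
    have hM : 0 < max (1 / a) (1 / b) := lt_max_of_lt_left (by positivity)
    rw [div_le_iff₀ (by positivity)]
    have e1 : (2 * x / a) ^ 2 = 4 * ((1 / a) * (x ^ 2 / a)) := by ring
    have e2 : (2 * y / b) ^ 2 = 4 * ((1 / b) * (y ^ 2 / b)) := by ring
    rw [e1, e2]
    have h1 := mul_le_mul_of_nonneg_right (le_max_left (1 / a) (1 / b)) hx
    have h2 := mul_le_mul_of_nonneg_right (le_max_right (1 / a) (1 / b)) hy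
    have h3 := mul_pos hM hδ
    linarith
  refine ⟨key, ?_⟩
  have hv := ellipse_vol a b w ha hb hw
  have := norm_setIntegral_le_of_norm_le_const (μ := volume)
    (s := {p : ℝ × ℝ | p.1 ^ 2 / a + p.2 ^ 2 / b ≤ w ^ 2})
    (f := fun p : ℝ × ℝ => ((2 * p.1 / a) ^ 2 + (2 * p.2 / b) ^ 2) /
            (3 * (δ + p.1 ^ 2 / a + p.2 ^ 2 / b))) (C := 4 / 3 * max (1 / a) (1 / b))
    (by rw [hv]; exact ENNReal.ofReal_lt_top) (by
      intro p _
      rw [Real.norm_of_nonneg (by positivity), mul_comm 3, ← div_div]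
      have := key p.1 p.2
      linarith)
  refine (le_abs_self _).trans (this.trans (le_of_eq ?_))
  rw [measureReal_def, hv, ENNReal.toReal_ofReal (by positivity)]
  ring
end

section
/- Fix α > 0, w > 0 and δ > 0, let h_δ(x) = δ + x²/α, let Π_δ = {(x,y) ∈ ℝ² : |x| < w, 0 < y < h_δ(x)}, and let φ_δ(x,y) = y/h_δ(x) (a smooth function on ℝ², since h_δ ≥ δ > 0). Then ∫_{Π_δ} ‖∇φ_δ(x,y)‖² dx dy = ∫_{−w}^{w} ( 1/h_δ(x) + h_δ'(x)²/(3·h_δ(x)) ) dx, where ∇ denotes the gradient and the left-hand integral is with respect to two-dimensional Lebesgue measure. -/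
open MeasureTheory Real

lemma keller_grad (α δ : ℝ) (hα : 0 < α) (hδ : 0 < δ) (p : EuclideanSpace ℝ (Fin 2)) :
    ‖gradient (fun q : EuclideanSpace ℝ (Fin 2) => q 1 / (δ + (q 0) ^ 2 / α)) p‖ ^ 2 =
      (p 1) ^ 2 * ((2 * p 0 / α) ^ 2 / (δ + (p 0) ^ 2 / α) ^ 4) + 1 / (δ + (p 0) ^ 2 / α) ^ 2 := by
  have hpos : 0 < δ + (p 0) ^ 2 / α := by positivity
  have h0 : HasFDerivAt (fun q : EuclideanSpace ℝ (Fin 2) => q 0)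
      (EuclideanSpace.proj 0 : EuclideanSpace ℝ (Fin 2) →L[ℝ] ℝ) p :=
    (EuclideanSpace.proj 0 : EuclideanSpace ℝ (Fin 2) →L[ℝ] ℝ).hasFDerivAt
  have h1 : HasFDerivAt (fun q : EuclideanSpace ℝ (Fin 2) => q 1)
      (EuclideanSpace.proj 1 : EuclideanSpace ℝ (Fin 2) →L[ℝ] ℝ) p :=
    (EuclideanSpace.proj 1 : EuclideanSpace ℝ (Fin 2) →L[ℝ] ℝ).hasFDerivAt
  have hd : HasDerivAt (fun t : ℝ => (δ + t ^ 2 / α)⁻¹)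
      (-(2 * p 0 / α) / (δ + (p 0) ^ 2 / α) ^ 2) (p 0) := by
    have : HasDerivAt (fun t : ℝ => δ + t ^ 2 / α) (2 * p 0 / α) (p 0) := by
      simpa using (((hasDerivAt_id (p 0)).pow 2).div_const α).const_add δ
    exact this.inv hpos.ne'
  have hf := h1.mul (hd.comp_hasFDerivAt p h0)
  have hg : HasGradientAt (fun q : EuclideanSpace ℝ (Fin 2) => q 1 / (δ + (q 0) ^ 2 / α))
      (!₂[p 1 * (-(2 * p 0 / α) / (δ + (p 0) ^ 2 / α) ^ 2), (δ + (p 0) ^ 2 / α)⁻¹]) p := by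
    rw [hasGradientAt_iff_hasFDerivAt]
    refine (hf.congr_fderiv ?_)
    ext v
    simp [PiLp.inner_apply, Fin.sum_univ_two]
    ring
  rw [hg.gradient, EuclideanSpace.norm_sq_eq]
  simp only [Fin.sum_univ_two, Real.norm_eq_abs, sq_abs]
  simp
  field_simp

theorem keller_prod (α w δ : ℝ) (hα : 0 < α) (hw : 0 < w) (hδ : 0 < δ) :
    (∫ p in {p : ℝ × ℝ | |p.1| < w ∧ 0 < p.2 ∧ p.2 < δ + (p.1) ^ 2 / α},
      (p.2 ^ 2 * ((2 * p.1 / α) ^ 2 / (δ + p.1 ^ 2 / α) ^ 4) + 1 / (δ + p.1 ^ 2 / α) ^ 2)) =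
      ∫ x in (-w)..w,
        (1 / (δ + x ^ 2 / α) + (2 * x / α) ^ 2 / (3 * (δ + x ^ 2 / α))) := by
  have hpos : ∀ x : ℝ, 0 < δ + x ^ 2 / α := fun x => by positivity
  set S := {p : ℝ × ℝ | |p.1| < w ∧ 0 < p.2 ∧ p.2 < δ + (p.1) ^ 2 / α} with hS
  set F : ℝ × ℝ → ℝ := fun p =>
    (p.2 ^ 2 * ((2 * p.1 / α) ^ 2 / (δ + p.1 ^ 2 / α) ^ 4) + 1 / (δ + p.1 ^ 2 / α) ^ 2) with hF
  have hFc : Continuous F := by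
    have h4 : ∀ p : ℝ × ℝ, (δ + p.1 ^ 2 / α) ^ 4 ≠ 0 := fun p => (pow_pos (hpos _) _).ne'
    have h2 : ∀ p : ℝ × ℝ, (δ + p.1 ^ 2 / α) ^ 2 ≠ 0 := fun p => (pow_pos (hpos _) _).ne'
    fun_prop (disch := assumption)
  have hSm : MeasurableSet S := by
    have : IsOpen S := by
      have a : IsOpen {p : ℝ × ℝ | |p.1| < w} := isOpen_lt (by fun_prop) (by fun_prop)
      have b : IsOpen {p : ℝ × ℝ | 0 < p.2} := isOpen_lt (by fun_prop) (by fun_prop)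
      have c : IsOpen {p : ℝ × ℝ | p.2 < δ + (p.1) ^ 2 / α} :=
        isOpen_lt (by fun_prop) (by fun_prop)
      exact a.inter (b.inter c)
    exact this.measurableSet
  have hint : IntegrableOn F S := by
    have hc : IsCompact (Set.Icc (-w) w ×ˢ Set.Icc 0 (δ + w ^ 2 / α)) :=
      isCompact_Icc.prod isCompact_Icc
    refine (hFc.continuousOn.integrableOn_compact hc).mono_set ?_
    rintro ⟨x, y⟩ ⟨h1, h2, h3⟩
    simp only at h1 h2 h3
    have h4 : x ^ 2 ≤ w ^ 2 := by rw [← sq_abs]; gcongr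
    have h5 : x ^ 2 / α ≤ w ^ 2 / α := by gcongr
    have := abs_lt.1 h1
    exact ⟨⟨this.1.le, this.2.le⟩, h2.le, by linarith⟩
  rw [← integral_indicator hSm, Measure.volume_eq_prod, integral_prod _ (by
    rw [← Measure.volume_eq_prod]; exact (integrable_indicator_iff hSm).2 hint)]
  rw [intervalIntegral.integral_of_le (by linarith), integral_Ioc_eq_integral_Ioo,
    ← integral_indicator measurableSet_Ioo]
  congr 1
  ext x
  by_cases hx : x ∈ Set.Ioo (-w) w
  · rw [Set.indicator_of_mem hx]
    have : ∀ y, S.indicator F (x, y) = (Set.Ioo 0 (δ + x ^ 2 / α)).indicator (fun y => F (x, y)) y := by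
      intro y
      have : (x, y) ∈ S ↔ y ∈ Set.Ioo 0 (δ + x ^ 2 / α) := by
        have := abs_lt.2 hx
        simp [hS, this]
      simp only [Set.indicator, this]
    rw [integral_congr_ae (ae_of_all _ this)]
    rw [integral_indicator measurableSet_Ioo, ← integral_Ioc_eq_integral_Ioo,
      ← intervalIntegral.integral_of_le (hpos x).le]
    simp only [hF]
    rw [intervalIntegral.integral_add (Continuous.intervalIntegrable (by fun_prop) _ _) (by simp),
      intervalIntegral.integral_mul_const, integral_pow, intervalIntegral.integral_const]
    have := (hpos x).ne'
    generalize δ + x ^ 2 / α = H at *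
    simp only [smul_eq_mul]
    field_simp
    norm_num
    ring
  · rw [Set.indicator_of_notMem hx]
    have : ∀ y, S.indicator F (x, y) = 0 := by
      intro y
      apply Set.indicator_of_notMem
      intro h
      exact hx (abs_lt.1 h.1)
    rw [integral_congr_ae (ae_of_all _ this)]
    simp

/-- Exact Dirichlet energy of the 2D Keller test function `φ_δ(x,y) = y / h_δ(x)`
over the model neck `Π_δ = {|x| < w, 0 < y < h_δ(x)}`, where `h_δ(x) = δ + x²/α`:
`∫_{Π_δ} ‖∇φ_δ‖² = ∫_{-w}^{w} (1/h_δ + h_δ'²/(3 h_δ))`. -/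
theorem keller_energy_2d (α w δ : ℝ) (hα : 0 < α) (hw : 0 < w) (hδ : 0 < δ) :
    (∫ p in {p : EuclideanSpace ℝ (Fin 2) |
        |p 0| < w ∧ 0 < p 1 ∧ p 1 < δ + (p 0) ^ 2 / α},
        ‖gradient (fun q : EuclideanSpace ℝ (Fin 2) =>
          q 1 / (δ + (q 0) ^ 2 / α)) p‖ ^ 2) =
      ∫ x in (-w)..w,
        (1 / (δ + x ^ 2 / α) +
          (deriv (fun t : ℝ => δ + t ^ 2 / α) x) ^ 2 / (3 * (δ + x ^ 2 / α))) := by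
  simp_rw [keller_grad α δ hα hδ]
  have hd : ∀ x : ℝ, deriv (fun t : ℝ => δ + t ^ 2 / α) x = 2 * x / α := by
    intro x
    have : HasDerivAt (fun t : ℝ => δ + t ^ 2 / α) (2 * x / α) x := by
      simpa using (((hasDerivAt_id x).pow 2).div_const α).const_add δ
    exact this.deriv
  simp_rw [hd]
  rw [← keller_prod α w δ hα hw hδ]
  have hm := (volume_preserving_finTwoArrow ℝ).comp
    (EuclideanSpace.volume_preserving_symm_measurableEquiv_toLp (Fin 2))
  have he : MeasurableEmbedding (MeasurableEquiv.finTwoArrow ∘ (MeasurableEquiv.toLp 2 (Fin 2 → ℝ)).symm) :=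
    (MeasurableEquiv.finTwoArrow (α := ℝ)).measurableEmbedding.comp
      (MeasurableEquiv.toLp 2 (Fin 2 → ℝ)).symm.measurableEmbedding
  rw [← hm.setIntegral_preimage_emb he]
  rfl
end

section
/- Fix a > 0, b > 0, w > 0 and δ > 0, let ĥ_δ(x,y) = δ + x²/a + y²/b, let Π̂_δ = {(x,y,z) ∈ ℝ³ : x²/a + y²/b < w², 0 < z < ĥ_δ(x,y)}, and let φ̂_δ(x,y,z) = z/ĥ_δ(x,y) (a smooth function on ℝ³, since ĥ_δ ≥ δ > 0). Then ∫_{Π̂_δ} ‖∇φ̂_δ‖² dx dy dz = ∫_{E_w} ( 1/ĥ_δ(x,y) + ‖∇ĥ_δ(x,y)‖²/(3·ĥ_δ(x,y)) ) dx dy, where E_w = {(x,y) ∈ ℝ² : x²/a + y²/b ≤ w²}, ∇ denotes the gradient, and the left-hand integral is with respect to three-dimensional Lebesgue measure. -/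
open MeasureTheory Real

theorem grad2 (a b δ : ℝ) (p : EuclideanSpace ℝ (Fin 2)) :
   ‖gradient (fun r : EuclideanSpace ℝ (Fin 2) =>
            δ + (r 0) ^ 2 / a + (r 1) ^ 2 / b) p‖ ^ 2 = (2 * p 0 / a)^2 + (2 * p 1 / b)^2 := by
  have hx := (show HasFDerivAt (fun r : EuclideanSpace ℝ (Fin 2) => r 0) (EuclideanSpace.proj 0 : EuclideanSpace ℝ (Fin 2) →L[ℝ] ℝ) p from
    ContinuousLinearMap.hasFDerivAt (EuclideanSpace.proj 0 : EuclideanSpace ℝ (Fin 2) →L[ℝ] ℝ))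
  have hy := (show HasFDerivAt (fun r : EuclideanSpace ℝ (Fin 2) => r 1) (EuclideanSpace.proj 1 : EuclideanSpace ℝ (Fin 2) →L[ℝ] ℝ) p from
    ContinuousLinearMap.hasFDerivAt (EuclideanSpace.proj 1 : EuclideanSpace ℝ (Fin 2) →L[ℝ] ℝ))
  have h := (((hx.pow 2).mul_const a⁻¹).const_add δ).add ((hy.pow 2).mul_const b⁻¹)
  have : HasGradientAt (fun r : EuclideanSpace ℝ (Fin 2) =>
            δ + (r 0) ^ 2 / a + (r 1) ^ 2 / b) !₂[2 * p 0 / a, 2 * p 1 / b] p := by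
    rw [hasGradientAt_iff_hasFDerivAt]
    simp only [div_eq_mul_inv]
    refine HasFDerivAt.congr_fderiv h ?_
    ext v
    simp [PiLp.inner_apply, Fin.sum_univ_two]
    ring
  rw [this.gradient, EuclideanSpace.real_norm_sq_eq]
  simp [Fin.sum_univ_two]

theorem grad3 (a b δ : ℝ) (p : EuclideanSpace ℝ (Fin 3)) (hh : δ + (p 0) ^ 2 / a + (p 1) ^ 2 / b ≠ 0) :
   ‖gradient (fun q : EuclideanSpace ℝ (Fin 3) =>
          q 2 / (δ + (q 0) ^ 2 / a + (q 1) ^ 2 / b)) p‖ ^ 2 =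
    1 / (δ + (p 0) ^ 2 / a + (p 1) ^ 2 / b)^2 + (p 2)^2 * (((2 * p 0 / a)^2 + (2 * p 1 / b)^2) / (δ + (p 0) ^ 2 / a + (p 1) ^ 2 / b)^4) := by
  have hx := (show HasFDerivAt (fun r : EuclideanSpace ℝ (Fin 3) => r 0) (EuclideanSpace.proj 0 : EuclideanSpace ℝ (Fin 3) →L[ℝ] ℝ) p from
    ContinuousLinearMap.hasFDerivAt (EuclideanSpace.proj 0 : EuclideanSpace ℝ (Fin 3) →L[ℝ] ℝ))
  have hy := (show HasFDerivAt (fun r : EuclideanSpace ℝ (Fin 3) => r 1) (EuclideanSpace.proj 1 : EuclideanSpace ℝ (Fin 3) →L[ℝ] ℝ) p from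
    ContinuousLinearMap.hasFDerivAt (EuclideanSpace.proj 1 : EuclideanSpace ℝ (Fin 3) →L[ℝ] ℝ))
  have hz := (show HasFDerivAt (fun r : EuclideanSpace ℝ (Fin 3) => r 2) (EuclideanSpace.proj 2 : EuclideanSpace ℝ (Fin 3) →L[ℝ] ℝ) p from
    ContinuousLinearMap.hasFDerivAt (EuclideanSpace.proj 2 : EuclideanSpace ℝ (Fin 3) →L[ℝ] ℝ))
  have h := (((hx.pow 2).mul_const a⁻¹).const_add δ).add ((hy.pow 2).mul_const b⁻¹)
  have h2 := hz.mul ((hasDerivAt_inv hh).comp_hasFDerivAt p h)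
  generalize hH : δ + (p 0) ^ 2 / a + (p 1) ^ 2 / b = H at *
  have : HasGradientAt (fun q : EuclideanSpace ℝ (Fin 3) =>
          q 2 / (δ + (q 0) ^ 2 / a + (q 1) ^ 2 / b)) !₂[- (p 2 * (2 * p 0 / a) / H^2), - (p 2 * (2 * p 1 / b) / H^2), 1 / H] p := by
    rw [hasGradientAt_iff_hasFDerivAt]
    simp only [div_eq_mul_inv]
    refine HasFDerivAt.congr_fderiv h2 ?_
    ext v
    have e : δ + (p 0) ^ 2 * a⁻¹ + (p 1) ^ 2 * b⁻¹ = H := hH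
    simp [PiLp.inner_apply, Fin.sum_univ_three, e]
    ring
  rw [this.gradient, EuclideanSpace.real_norm_sq_eq]
  simp [Fin.sum_univ_three]
  ring

theorem ellipse_null (a b w : ℝ) (hb : 0 < b) :
    volume {q : Fin 2 → ℝ | (q 0) ^ 2 / a + (q 1) ^ 2 / b = w ^ 2} = 0 := by
  have hm : MeasurableSet {q : ℝ × ℝ | q.1 ^ 2 / a + q.2 ^ 2 / b = w ^ 2} :=
    measurableSet_eq_fun (by fun_prop) (by fun_prop)
  have := (volume_preserving_finTwoArrow ℝ).measure_preimage hm.nullMeasurableSet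
  have h0 : volume {q : ℝ × ℝ | q.1 ^ 2 / a + q.2 ^ 2 / b = w ^ 2} = 0 := by
    rw [Measure.volume_eq_prod, Measure.measure_prod_null hm]
    refine Filter.Eventually.of_forall fun x => ?_
    apply Set.Finite.measure_zero
    apply Set.Finite.subset (Set.toFinite {√(b * (w^2 - x^2/a)), -√(b * (w^2 - x^2/a))})
    intro y hy
    have hy : x ^ 2 / a + y ^ 2 / b = w ^ 2 := hy
    have e : b * (w^2 - x^2/a) = y^2 := by
      rw [← hy]; field_simp; ring
    simp only [Set.mem_insert_iff, Set.mem_singleton_iff, e, Real.sqrt_sq_eq_abs]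
    rcases abs_choice y with h | h <;> rw [h] <;> simp
  rw [h0] at this
  exact this

theorem slice_int (H g : ℝ) (hH : 0 < H) :
    ∫ z in Set.Ioo 0 H, (1 / H ^ 2 + z ^ 2 * (g / H ^ 4)) = 1 / H + g / (3 * H) := by
  rw [← integral_Ioc_eq_integral_Ioo, ← intervalIntegral.integral_of_le hH.le,
    intervalIntegral.integral_add (by simp) (by apply Continuous.intervalIntegrable; fun_prop),
    intervalIntegral.integral_mul_const, integral_pow]
  simp
  field_simp
  ring

theorem integrableF (a b w δ : ℝ) (ha : 0 < a) (hb : 0 < b) (hδ : 0 < δ) :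
    IntegrableOn (fun p : ℝ × (Fin 2 → ℝ) => 1 / (δ + (p.2 0) ^ 2 / a + (p.2 1) ^ 2 / b)^2 +
      p.1^2 * (((2 * p.2 0 / a)^2 + (2 * p.2 1 / b)^2) / (δ + (p.2 0) ^ 2 / a + (p.2 1) ^ 2 / b)^4))
      {p : ℝ × (Fin 2 → ℝ) | (p.2 0) ^ 2 / a + (p.2 1) ^ 2 / b < w ^ 2 ∧
          0 < p.1 ∧ p.1 < δ + (p.2 0) ^ 2 / a + (p.2 1) ^ 2 / b} := by
  have hc : Continuous (fun p : ℝ × (Fin 2 → ℝ) => 1 / (δ + (p.2 0) ^ 2 / a + (p.2 1) ^ 2 / b)^2 +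
      p.1^2 * (((2 * p.2 0 / a)^2 + (2 * p.2 1 / b)^2) / (δ + (p.2 0) ^ 2 / a + (p.2 1) ^ 2 / b)^4)) := by
    have h : ∀ p : ℝ × (Fin 2 → ℝ), δ + (p.2 0) ^ 2 / a + (p.2 1) ^ 2 / b ≠ 0 := fun p => by positivity
    fun_prop (disch := intro p; exact pow_ne_zero _ (h p))
  have hK : IsCompact (Set.Icc (0:ℝ) (δ + w^2) ×ˢ
      Set.Icc (fun i : Fin 2 => -√((a + b) * w^2)) (fun i => √((a + b) * w^2))) :=
    isCompact_Icc.prod isCompact_Icc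
  refine (hc.continuousOn.integrableOn_compact hK).mono_set ?_
  rintro ⟨z, q⟩ ⟨h1, h2, h3⟩
  dsimp only at h1 h2 h3
  have hx : 0 ≤ q 0 ^ 2 / a := by positivity
  have hy : 0 ≤ q 1 ^ 2 / b := by positivity
  have hx' : q 0 ^ 2 ≤ (a + b) * w^2 := by
    have : q 0 ^ 2 / a ≤ w^2 := by linarith
    rw [div_le_iff₀ ha] at this
    nlinarith [mul_nonneg hb.le (sq_nonneg w)]
  have hy' : q 1 ^ 2 ≤ (a + b) * w^2 := by
    have : q 1 ^ 2 / b ≤ w^2 := by linarith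
    rw [div_le_iff₀ hb] at this
    nlinarith [mul_nonneg ha.le (sq_nonneg w)]
  have hx2 := abs_le.1 (Real.abs_le_sqrt hx')
  have hy2 := abs_le.1 (Real.abs_le_sqrt hy')
  refine ⟨⟨h2.le, by linarith⟩, ?_, ?_⟩
  · intro i; fin_cases i
    exacts [hx2.1, hy2.1]
  · intro i; fin_cases i
    exacts [hx2.2, hy2.2]

/-- Exact Dirichlet energy of the 3D Keller test function `φ̂_δ(x,y,z) = z / ĥ_δ(x,y)`
over the model neck `Π̂_δ = {x²/a + y²/b < w², 0 < z < ĥ_δ(x,y)}`, where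
`ĥ_δ(x,y) = δ + x²/a + y²/b`:
`∫_{Π̂_δ} ‖∇φ̂_δ‖² = ∫_{E_w} (1/ĥ_δ + ‖∇ĥ_δ‖²/(3 ĥ_δ))`. -/
theorem keller_energy_3d (a b w δ : ℝ) (ha : 0 < a) (hb : 0 < b) (hw : 0 < w) (hδ : 0 < δ) :
    (∫ p in {p : EuclideanSpace ℝ (Fin 3) |
        (p 0) ^ 2 / a + (p 1) ^ 2 / b < w ^ 2 ∧
          0 < p 2 ∧ p 2 < δ + (p 0) ^ 2 / a + (p 1) ^ 2 / b},
        ‖gradient (fun q : EuclideanSpace ℝ (Fin 3) =>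
          q 2 / (δ + (q 0) ^ 2 / a + (q 1) ^ 2 / b)) p‖ ^ 2) =
      ∫ q in {q : EuclideanSpace ℝ (Fin 2) | (q 0) ^ 2 / a + (q 1) ^ 2 / b ≤ w ^ 2},
        (1 / (δ + (q 0) ^ 2 / a + (q 1) ^ 2 / b) +
          ‖gradient (fun r : EuclideanSpace ℝ (Fin 2) =>
            δ + (r 0) ^ 2 / a + (r 1) ^ 2 / b) q‖ ^ 2 /
            (3 * (δ + (q 0) ^ 2 / a + (q 1) ^ 2 / b))) := by
  have hpos : ∀ x y : ℝ, 0 < δ + x ^ 2 / a + y ^ 2 / b := fun x y => by positivity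
  have hne : ∀ x y : ℝ, δ + x ^ 2 / a + y ^ 2 / b ≠ 0 := fun x y => (hpos x y).ne'
  simp_rw [grad2, grad3 a b δ _ (hne _ _)]
  let S : Set (ℝ × (Fin 2 → ℝ)) := {p | (p.2 0) ^ 2 / a + (p.2 1) ^ 2 / b < w ^ 2 ∧
          0 < p.1 ∧ p.1 < δ + (p.2 0) ^ 2 / a + (p.2 1) ^ 2 / b}
  let F : ℝ × (Fin 2 → ℝ) → ℝ := fun p => 1 / (δ + (p.2 0) ^ 2 / a + (p.2 1) ^ 2 / b)^2 +
      p.1^2 * (((2 * p.2 0 / a)^2 + (2 * p.2 1 / b)^2) / (δ + (p.2 0) ^ 2 / a + (p.2 1) ^ 2 / b)^4)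
  let E : Set (Fin 2 → ℝ) := {q | (q 0) ^ 2 / a + (q 1) ^ 2 / b ≤ w ^ 2}
  let E' : Set (Fin 2 → ℝ) := {q | (q 0) ^ 2 / a + (q 1) ^ 2 / b < w ^ 2}
  let G : (Fin 2 → ℝ) → ℝ := fun q => 1 / (δ + (q 0) ^ 2 / a + (q 1) ^ 2 / b) +
      ((2 * q 0 / a)^2 + (2 * q 1 / b)^2) / (3 * (δ + (q 0) ^ 2 / a + (q 1) ^ 2 / b))
  have hS : MeasurableSet S := by
    have h1 : MeasurableSet {p : ℝ × (Fin 2 → ℝ) | (p.2 0) ^ 2 / a + (p.2 1) ^ 2 / b < w ^ 2} :=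
      measurableSet_lt (by fun_prop) (by fun_prop)
    have h2 : MeasurableSet {p : ℝ × (Fin 2 → ℝ) | 0 < p.1} :=
      measurableSet_lt (by fun_prop) (by fun_prop)
    have h3 : MeasurableSet {p : ℝ × (Fin 2 → ℝ) |
        p.1 < δ + (p.2 0) ^ 2 / a + (p.2 1) ^ 2 / b} :=
      measurableSet_lt (by fun_prop) (by fun_prop)
    exact h1.inter (h2.inter h3)
  have hE' : MeasurableSet E' := measurableSet_lt (by fun_prop) (by fun_prop)
  have hL := ((volume_preserving_piFinSuccAbove (fun _ : Fin 3 => ℝ) 2).comp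
    (PiLp.volume_preserving_ofLp (Fin 3))).setIntegral_preimage_emb
    ((MeasurableEquiv.measurableEmbedding _).comp
      (MeasurableEquiv.toLp 2 (Fin 3 → ℝ)).symm.measurableEmbedding) F S
  have hR := (PiLp.volume_preserving_ofLp (Fin 2)).setIntegral_preimage_emb
      (MeasurableEquiv.toLp 2 (Fin 2 → ℝ)).symm.measurableEmbedding G E
  refine Eq.trans hL (Eq.trans ?_ hR.symm)
  have hEE : E =ᵐ[volume] E' := by
    have h := measure_eq_zero_iff_ae_notMem.1 (ellipse_null a b w hb)
    filter_upwards [h] with q hq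
    refine propext ⟨fun h1 => lt_of_le_of_ne h1 hq, fun h1 => le_of_lt h1⟩
  rw [setIntegral_congr_set hEE, ← integral_indicator hS, ← integral_indicator hE',
    Measure.volume_eq_prod, integral_prod_symm _
      ((integrable_indicator_iff hS).2 (integrableF a b w δ ha hb hδ))]
  congr 1
  ext q
  by_cases hq : q ∈ E'
  · rw [Set.indicator_of_mem hq]
    refine Eq.trans ?_ (slice_int _ _ (hpos (q 0) (q 1)))
    rw [← integral_indicator measurableSet_Ioo]
    congr 1
    ext z
    refine Set.indicator_eq_indicator ⟨fun h => h.2, fun h => ⟨hq, h⟩⟩ rfl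
  · rw [Set.indicator_of_notMem hq]
    have : ∀ z, S.indicator F (z, q) = 0 := fun z => Set.indicator_of_notMem (fun h => hq h.1) _
    exact (integral_congr_ae (Filter.Eventually.of_forall this)).trans (integral_zero _ _)
end

section
/- Fix α > 0, w > 0 and δ > 0, let h_δ(x) = δ + x²/α, let Π_δ = {(x,y) ∈ ℝ² : |x| < w, 0 < y < h_δ(x)}, let φ_δ(x,y) = y/h_δ(x), and let the test flux be j_δ(x,y) = (0, 1/h_δ(x)). Then ∫_{Π_δ} ‖∇φ_δ(x,y) − j_δ(x,y)‖² dx dy = ∫_{−w}^{w} h_δ'(x)²/(3·h_δ(x)) dx. -/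
open MeasureTheory Real

lemma grad_k (α δ : ℝ) (hα : 0 < α) (hδ : 0 < δ) (p : EuclideanSpace ℝ (Fin 2)) :
  gradient (fun q : EuclideanSpace ℝ (Fin 2) => q 1 / (δ + (q 0) ^ 2 / α)) p =
   !₂[-(p 1 * (2 * p 0 / α)) / (δ + (p 0) ^ 2 / α)^2, 1 / (δ + (p 0) ^ 2 / α)] := by
  have hh : δ + (p 0) ^ 2 / α ≠ 0 := by positivity
  apply HasGradientAt.gradient
  rw [hasGradientAt_iff_hasFDerivAt]
  have h0 : HasFDerivAt (fun q : EuclideanSpace ℝ (Fin 2) => q 0) (EuclideanSpace.proj 0 : EuclideanSpace ℝ (Fin 2) →L[ℝ] ℝ) p := (EuclideanSpace.proj 0 : EuclideanSpace ℝ (Fin 2) →L[ℝ] ℝ).hasFDerivAt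
  have h1 : HasFDerivAt (fun q : EuclideanSpace ℝ (Fin 2) => q 1) (EuclideanSpace.proj 1 : EuclideanSpace ℝ (Fin 2) →L[ℝ] ℝ) p := (EuclideanSpace.proj 1 : EuclideanSpace ℝ (Fin 2) →L[ℝ] ℝ).hasFDerivAt
  have h2 : HasFDerivAt (fun q : EuclideanSpace ℝ (Fin 2) => δ + (q 0)^2/α) _ p := 
    (HasDerivAt.comp_hasFDerivAt (h₂ := fun t : ℝ => δ + t^2/α) p (((hasDerivAt_pow 2 (p 0)).div_const α).const_add δ) h0)
  have h3 := h1.mul ((hasDerivAt_inv hh).comp_hasFDerivAt p h2)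
  simp only [div_eq_mul_inv _ (δ + _)]
  refine h3.congr_fderiv ?_
  ext v
  simp [PiLp.inner_apply, Fin.sum_univ_two]
  field_simp
  try ring

/-- The difference between the Keller test function's gradient and the dual test flux
`j_δ = (0, 1/h_δ(x))` over the model neck `Π_δ`, where `h_δ(x) = δ + x²/α` and
`φ_δ(x,y) = y / h_δ(x)`:
`∫_{Π_δ} ‖∇φ_δ - j_δ‖² = ∫_{-w}^{w} h_δ'(x)²/(3 h_δ(x)) dx`. -/
theorem keller_flux_gap_2d (α w δ : ℝ) (hα : 0 < α) (hw : 0 < w) (hδ : 0 < δ) :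
    (∫ p in {p : EuclideanSpace ℝ (Fin 2) |
        |p 0| < w ∧ 0 < p 1 ∧ p 1 < δ + (p 0) ^ 2 / α},
        ‖gradient (fun q : EuclideanSpace ℝ (Fin 2) =>
            q 1 / (δ + (q 0) ^ 2 / α)) p -
          (WithLp.equiv 2 (Fin 2 → ℝ)).symm ![0, 1 / (δ + (p 0) ^ 2 / α)]‖ ^ 2) =
      ∫ x in (-w)..w,
        (deriv (fun t : ℝ => δ + t ^ 2 / α) x) ^ 2 / (3 * (δ + x ^ 2 / α)) := by
  have hpos : ∀ x : ℝ, 0 < δ + x ^ 2 / α := fun x => by positivity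
  have hd : ∀ x : ℝ, deriv (fun t : ℝ => δ + t ^ 2 / α) x = 2 * x / α := fun x => by
    have := (((hasDerivAt_pow 2 x).div_const α).const_add δ).deriv
    simpa using this
  set F : ℝ × ℝ → ℝ := fun z => (z.2 * (2 * z.1 / α) / (δ + z.1 ^ 2 / α)^2)^2 with hF
  set S : Set (ℝ × ℝ) := {z | |z.1| < w ∧ 0 < z.2 ∧ z.2 < δ + z.1 ^ 2 / α} with hS
  have hn : ∀ p : EuclideanSpace ℝ (Fin 2), ‖gradient (fun q : EuclideanSpace ℝ (Fin 2) =>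
            q 1 / (δ + (q 0) ^ 2 / α)) p -
          (WithLp.equiv 2 (Fin 2 → ℝ)).symm ![0, 1 / (δ + (p 0) ^ 2 / α)]‖ ^ 2 = F (p 0, p 1) := by
    intro p
    rw [grad_k α δ hα hδ, EuclideanSpace.norm_sq_eq]
    simp [Fin.sum_univ_two, hF, neg_div]
  simp only [hn, hd]
  have hFc : Continuous F := by
    rw [hF]
    fun_prop (disch := intro z; have := hpos z.1; positivity)
  have hSm : MeasurableSet S := by
    rw [hS]
    refine (IsOpen.measurableSet ?_)
    have o1 : IsOpen {z : ℝ × ℝ | |z.1| < w} := isOpen_lt (by fun_prop) (by fun_prop)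
    have o2 : IsOpen {z : ℝ × ℝ | 0 < z.2} := isOpen_lt (by fun_prop) (by fun_prop)
    have o3 : IsOpen {z : ℝ × ℝ | z.2 < δ + z.1 ^ 2 / α} := isOpen_lt (by fun_prop) (by fun_prop)
    exact o1.inter (o2.inter o3)
  have hmp : MeasurePreserving ((MeasurableEquiv.finTwoArrow (α := ℝ)) ∘ (MeasurableEquiv.toLp 2 (Fin 2 → ℝ)).symm) :=
    (volume_preserving_finTwoArrow ℝ).comp (EuclideanSpace.volume_preserving_symm_measurableEquiv_toLp (Fin 2))
  have key := hmp.setIntegral_preimage_emb ((MeasurableEquiv.finTwoArrow (α := ℝ)).measurableEmbedding.comp (MeasurableEquiv.toLp 2 (Fin 2 → ℝ)).symm.measurableEmbedding) F S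
  refine Eq.trans key ?_
  have hint : IntegrableOn F S := by
    refine (hFc.continuousOn.integrableOn_compact (K := Set.Icc (-w) w ×ˢ Set.Icc 0 (δ + w^2/α)) (isCompact_Icc.prod isCompact_Icc)).mono_set ?_
    rintro ⟨x, y⟩ ⟨h1, h2, h3⟩
    simp only at h1 h2 h3
    have h4 := abs_lt.1 h1
    refine ⟨⟨h4.1.le, h4.2.le⟩, h2.le, h3.le.trans ?_⟩
    have : x^2 ≤ w^2 := sq_le_sq' h4.1.le h4.2.le
    gcongr
  rw [← integral_indicator hSm, Measure.volume_eq_prod, integral_prod _ (by rw [← Measure.volume_eq_prod]; exact (integrable_indicator_iff hSm).2 hint),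
    intervalIntegral.integral_of_le (by linarith), integral_Ioc_eq_integral_Ioo, ← integral_indicator measurableSet_Ioo]
  congr 1
  ext x
  by_cases hx : x ∈ Set.Ioo (-w) w
  · rw [Set.indicator_of_mem hx]
    have e : (fun y => S.indicator F (x, y)) = (Set.Ioo 0 (δ + x^2/α)).indicator (fun y => F (x,y)) := by
      ext y
      have : (x, y) ∈ S ↔ y ∈ Set.Ioo 0 (δ + x^2/α) := by
        simp [hS, abs_lt, hx.1, hx.2]
      simp only [Set.indicator, this]
    rw [e, integral_indicator measurableSet_Ioo, ← integral_Ioc_eq_integral_Ioo, ← intervalIntegral.integral_of_le (hpos x).le]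
    have hne := (hpos x).ne'
    have : ∀ y, F (x,y) = ((2 * x / α) / (δ + x ^ 2 / α)^2)^2 * y^2 := fun y => by simp only [hF]; ring
    simp only [this, intervalIntegral.integral_const_mul, integral_pow]
    generalize δ + x^2/α = h at *
    field_simp
    norm_num
  · rw [Set.indicator_of_notMem hx]
    have : ∀ y, S.indicator F (x, y) = 0 := fun y => Set.indicator_of_notMem (fun h => hx (abs_lt.1 h.1)) _
    simp [this]
end

section
/- Fix a > 0, b > 0, w > 0 and δ > 0, let ĥ_δ(x,y) = δ + x²/a + y²/b and Π̂_δ = {(x,y,z) ∈ ℝ³ : x²/a + y²/b < w², 0 < z < ĥ_δ(x,y)}. Let u : ℝ³ → ℝ be continuously differentiable on an open set containing the closure of Π̂_δ and satisfy u(x, y, 0) = 0 and u(x, y, ĥ_δ(x,y)) = 1 for all (x,y) with x²/a + y²/b ≤ w². Then ∫_{Π̂_δ} ‖∇u‖² dx dy dz ≥ ∫_{E_w} dx dy/ĥ_δ(x,y), where E_w = {(x,y) ∈ ℝ² : x²/a + y²/b ≤ w²}. -/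
open MeasureTheory Real

noncomputable def neckT (z : ℝ × (Fin 2 → ℝ)) : EuclideanSpace ℝ (Fin 3) :=
  WithLp.toLp 2 ![z.2 0, z.2 1, z.1]

lemma neckT_eq : neckT = (fun z => (MeasurableEquiv.toLp 2 (Fin 3 → ℝ))
    ((MeasurableEquiv.piFinSuccAbove (fun _ => ℝ) (2 : Fin 3)).symm z)) := by
  funext z
  ext i
  fin_cases i
  · simp [neckT, MeasurableEquiv.piFinSuccAbove, Fin.insertNthEquiv]
    exact (Fin.insertNth_apply_succAbove (α := fun _ => ℝ) (2 : Fin 3) z.1 z.2 0).symm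
  · simp [neckT, MeasurableEquiv.piFinSuccAbove, Fin.insertNthEquiv]
    exact (Fin.insertNth_apply_succAbove (α := fun _ => ℝ) (2 : Fin 3) z.1 z.2 1).symm
  · simp [neckT, MeasurableEquiv.piFinSuccAbove, Fin.insertNthEquiv]

lemma neckT_mp : MeasurePreserving neckT (volume : Measure (ℝ × (Fin 2 → ℝ))) volume := by
  rw [neckT_eq]
  exact (EuclideanSpace.volume_preserving_symm_measurableEquiv_toLp (Fin 3)).symm.comp
    (volume_preserving_piFinSuccAbove (fun _ => ℝ) (2 : Fin 3)).symm

lemma neckT_emb : MeasurableEmbedding neckT := by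
  rw [neckT_eq]
  exact (MeasurableEquiv.toLp 2 (Fin 3 → ℝ)).measurableEmbedding.comp
    (MeasurableEquiv.piFinSuccAbove (fun _ => ℝ) (2 : Fin 3)).symm.measurableEmbedding

lemma neck_boundary_null (a b w : ℝ) (ha : 0 < a) (hb : 0 < b) (hw : 0 < w) :
    (volume : Measure (Fin 2 → ℝ)) {q | (q 0) ^ 2 / a + (q 1) ^ 2 / b = w ^ 2} = 0 := by
  have hconv : Convex ℝ {q : Fin 2 → ℝ | (q 0) ^ 2 / a + (q 1) ^ 2 / b ≤ w ^ 2} := by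
    intro p hp q hq s t hs ht hst
    simp only [Set.mem_ofPred_eq, Pi.add_apply, Pi.smul_apply, smul_eq_mul] at *
    have key : ∀ x y : ℝ, (s * x + t * y) ^ 2 ≤ s * x ^ 2 + t * y ^ 2 := by
      intro x y
      have : t = 1 - s := by linarith
      subst this
      nlinarith [mul_nonneg (mul_nonneg hs ht) (sq_nonneg (x - y))]
    calc (s * p 0 + t * q 0) ^ 2 / a + (s * p 1 + t * q 1) ^ 2 / b
        ≤ (s * p 0 ^ 2 + t * q 0 ^ 2) / a + (s * p 1 ^ 2 + t * q 1 ^ 2) / b := by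
          gcongr <;> apply key
      _ = s * (p 0 ^ 2 / a + p 1 ^ 2 / b) + t * (q 0 ^ 2 / a + q 1 ^ 2 / b) := by ring
      _ ≤ s * w ^ 2 + t * w ^ 2 := by gcongr
      _ = w ^ 2 := by rw [← add_mul, hst, one_mul]
  refine measure_mono_null ?_ (hconv.addHaar_frontier volume)
  intro q hq
  refine ⟨subset_closure (le_of_eq hq), fun hi => ?_⟩
  have hc : ContinuousAt (fun t : ℝ => t • q) 1 := by fun_prop
  have h2 := hc.preimage_mem_nhds (by simpa using mem_interior_iff_mem_nhds.1 hi)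
  have h3 : ∀ᶠ t : ℝ in nhdsWithin 1 (Set.Ioi 1), t • q ∈
    {q : Fin 2 → ℝ | (q 0) ^ 2 / a + (q 1) ^ 2 / b ≤ w ^ 2} := nhdsWithin_le_nhds h2
  obtain ⟨t, ht, ht1⟩ := (h3.and self_mem_nhdsWithin).exists
  simp only [Set.mem_ofPred_eq, Pi.smul_apply, smul_eq_mul] at ht hq
  have ht1 : 1 < t := ht1
  have : (t * q 0) ^ 2 / a + (t * q 1) ^ 2 / b = t ^ 2 * w ^ 2 := by rw [← hq]; ring
  rw [this] at ht
  have h5 : 1 < t ^ 2 := by nlinarith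
  nlinarith [mul_pos (sub_pos.2 h5) (pow_pos hw 2)]

/-- one-dimensional slice estimate -/
lemma neck_slice (u : EuclideanSpace ℝ (Fin 3) → ℝ) (U : Set (EuclideanSpace ℝ (Fin 3)))
    (hU : IsOpen U) (hu : ContDiffOn ℝ 1 u U) (q : Fin 2 → ℝ) (h : ℝ) (hh : 0 < h)
    (hseg : ∀ z ∈ Set.Icc 0 h, neckT (z, q) ∈ U)
    (h0 : u (neckT (0, q)) = 0) (h1 : u (neckT (h, q)) = 1) :
    1 / h ≤ ∫ z in Set.Ioo 0 h, ‖gradient u (neckT (z, q))‖ ^ 2 := by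
  have hfd : ContinuousOn (fderiv ℝ u) U := hu.continuousOn_fderiv_of_isOpen hU le_rfl
  have hgr : ContinuousOn (gradient u) U := by
    unfold gradient
    exact (LinearIsometryEquiv.continuous _).comp_continuousOn hfd
  have hTc : Continuous (fun z : ℝ => neckT (z, q)) := by
    unfold neckT
    refine (PiLp.continuous_toLp 2 _).comp (continuous_pi fun i => ?_)
    fin_cases i <;> simp <;> fun_prop
  set e : EuclideanSpace ℝ (Fin 3) := EuclideanSpace.single 2 1 with he
  have hen : ‖e‖ = 1 := by simp [he]
  have hTd : ∀ z : ℝ, HasDerivAt (fun z : ℝ => neckT (z, q)) e z := by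
    intro z
    have h2 : (fun z : ℝ => neckT (z, q)) = fun z => neckT (0, q) + z • e := by
      funext z
      ext i
      fin_cases i <;> simp [neckT, he]
    rw [h2]
    simpa using ((hasDerivAt_id z).smul_const e).const_add (neckT (0, q))
  have hd : ∀ z ∈ Set.uIcc 0 h, HasDerivAt (fun z => u (neckT (z, q)))
      (fderiv ℝ u (neckT (z, q)) e) z := by
    intro z hz
    rw [Set.uIcc_of_le hh.le] at hz
    have := ((hu.differentiableOn one_ne_zero).differentiableAt
      (hU.mem_nhds (hseg z hz))).hasFDerivAt
    exact this.comp_hasDerivAt z (hTd z)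
  have hdc : ContinuousOn (fun z => fderiv ℝ u (neckT (z, q)) e) (Set.uIcc 0 h) := by
    rw [Set.uIcc_of_le hh.le]
    exact (hfd.comp hTc.continuousOn hseg).clm_apply continuousOn_const
  have hgc : ContinuousOn (fun z => ‖gradient u (neckT (z, q))‖ ^ 2) (Set.uIcc 0 h) := by
    rw [Set.uIcc_of_le hh.le]
    exact (hgr.comp hTc.continuousOn hseg).norm.pow 2
  have hftc := intervalIntegral.integral_eq_sub_of_hasDerivAt hd hdc.intervalIntegrable
  rw [h0, h1, sub_zero] at hftc
  have hpt : ∀ z, 2 / h * fderiv ℝ u (neckT (z, q)) e - (1 / h) ^ 2 ≤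
      ‖gradient u (neckT (z, q))‖ ^ 2 := by
    intro z
    have h3 : |fderiv ℝ u (neckT (z, q)) e| ≤ ‖gradient u (neckT (z, q))‖ := by
      have : ‖gradient u (neckT (z, q))‖ = ‖fderiv ℝ u (neckT (z, q))‖ := by
        unfold gradient; simp
      rw [this]
      simpa [hen] using (fderiv ℝ u (neckT (z, q))).le_opNorm e
    have h4 := sq_le_sq' (by linarith [abs_nonneg (fderiv ℝ u (neckT (z, q)) e), norm_nonneg (gradient u (neckT (z, q)))]) h3
    rw [sq_abs] at h4
    have : 2 / h = 2 * (1 / h) := by ring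
    rw [this]
    nlinarith [sq_nonneg (fderiv ℝ u (neckT (z, q)) e - 1 / h)]
  rw [← integral_Ioc_eq_integral_Ioo, ← intervalIntegral.integral_of_le hh.le]
  calc 1 / h = ∫ z in (0:ℝ)..h, (2 / h * fderiv ℝ u (neckT (z, q)) e - (1 / h) ^ 2) := by
        rw [intervalIntegral.integral_sub (hdc.intervalIntegrable.const_mul _) (by simp),
          intervalIntegral.integral_const_mul, hftc, intervalIntegral.integral_const]
        simp
        field_simp
        norm_num
    _ ≤ _ := intervalIntegral.integral_mono_on hh.le
        ((hdc.intervalIntegrable.const_mul _).sub (by simp)) hgc.intervalIntegrable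
        (fun z _ => hpt z)

theorem neck_energy_lower_bound_3d (a b w δ : ℝ) (ha : 0 < a) (hb : 0 < b)
    (hw : 0 < w) (hδ : 0 < δ)
    (u : EuclideanSpace ℝ (Fin 3) → ℝ) (U : Set (EuclideanSpace ℝ (Fin 3)))
    (hU : IsOpen U)
    (hcl : closure {p : EuclideanSpace ℝ (Fin 3) |
      (p 0) ^ 2 / a + (p 1) ^ 2 / b < w ^ 2 ∧
        0 < p 2 ∧ p 2 < δ + (p 0) ^ 2 / a + (p 1) ^ 2 / b} ⊆ U)
    (hu : ContDiffOn ℝ 1 u U)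
    (h0 : ∀ x y : ℝ, x ^ 2 / a + y ^ 2 / b ≤ w ^ 2 →
      u ((WithLp.equiv 2 (Fin 3 → ℝ)).symm ![x, y, 0]) = 0)
    (h1 : ∀ x y : ℝ, x ^ 2 / a + y ^ 2 / b ≤ w ^ 2 →
      u ((WithLp.equiv 2 (Fin 3 → ℝ)).symm ![x, y, δ + x ^ 2 / a + y ^ 2 / b]) = 1) :
    (∫ p in {p : EuclideanSpace ℝ (Fin 3) |
        (p 0) ^ 2 / a + (p 1) ^ 2 / b < w ^ 2 ∧
          0 < p 2 ∧ p 2 < δ + (p 0) ^ 2 / a + (p 1) ^ 2 / b},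
        ‖gradient u p‖ ^ 2) ≥
      ∫ q in {q : EuclideanSpace ℝ (Fin 2) | (q 0) ^ 2 / a + (q 1) ^ 2 / b ≤ w ^ 2},
        1 / (δ + (q 0) ^ 2 / a + (q 1) ^ 2 / b) := by
  set V := {p : EuclideanSpace ℝ (Fin 3) |
      (p 0) ^ 2 / a + (p 1) ^ 2 / b < w ^ 2 ∧
        0 < p 2 ∧ p 2 < δ + (p 0) ^ 2 / a + (p 1) ^ 2 / b} with hV
  have hgr : ContinuousOn (fun p => ‖gradient u p‖ ^ 2) U := by
    have hfd : ContinuousOn (fderiv ℝ u) U := hu.continuousOn_fderiv_of_isOpen hU le_rfl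
    unfold gradient
    exact ((LinearIsometryEquiv.continuous _).comp_continuousOn hfd).norm.pow 2
  have hVo : IsOpen V := by
    refine IsOpen.and (isOpen_lt (by fun_prop) (by fun_prop)) (IsOpen.and
      (isOpen_lt (by fun_prop) (by fun_prop)) (isOpen_lt (by fun_prop) (by fun_prop)))
  have hVb : Bornology.IsBounded V := by
    refine (Metric.isBounded_closedBall (x := (0 : EuclideanSpace ℝ (Fin 3)))
      (r := √(a * w ^ 2 + b * w ^ 2 + (δ + w ^ 2) ^ 2))).subset ?_
    rintro p ⟨hp1, hp2, hp3⟩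
    rw [mem_closedBall_zero_iff]
    apply Real.le_sqrt_of_sq_le
    rw [EuclideanSpace.norm_sq_eq, Fin.sum_univ_three]
    simp only [Real.norm_eq_abs, sq_abs]
    have e0 : 0 ≤ p 0 ^ 2 / a := by positivity
    have e1 : 0 ≤ p 1 ^ 2 / b := by positivity
    have f0 : p 0 ^ 2 ≤ a * w ^ 2 := by
      have : p 0 ^ 2 / a ≤ w ^ 2 := by linarith
      rw [div_le_iff₀ ha] at this; linarith
    have f1 : p 1 ^ 2 ≤ b * w ^ 2 := by
      have : p 1 ^ 2 / b ≤ w ^ 2 := by linarith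
      rw [div_le_iff₀ hb] at this; linarith
    have f2 : p 2 ^ 2 ≤ (δ + w ^ 2) ^ 2 := by
      apply pow_le_pow_left₀ hp2.le; linarith
    linarith
  have hint : IntegrableOn (fun p => ‖gradient u p‖ ^ 2) V :=
    ((hgr.mono hcl).integrableOn_compact hVb.isCompact_closure).mono_set subset_closure
  have hTV : MeasurableSet (neckT ⁻¹' V) := neckT_mp.measurable hVo.measurableSet
  have hint2 : IntegrableOn (fun z => ‖gradient u (neckT z)‖ ^ 2) (neckT ⁻¹' V) :=
    (neckT_mp.integrableOn_comp_preimage neckT_emb).2 hint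
  rw [← neckT_mp.setIntegral_preimage_emb neckT_emb, ← integral_indicator hTV]
  have hint3 := (integrable_indicator_iff hTV).2 hint2
  rw [Measure.volume_eq_prod] at hint3 ⊢
  rw [integral_prod_symm _ hint3]
  have hE := (EuclideanSpace.volume_preserving_symm_measurableEquiv_toLp (Fin 2)).symm
  rw [← hE.setIntegral_preimage_emb (MeasurableEquiv.measurableEmbedding _)]
  have hEm : MeasurableSet {q : Fin 2 → ℝ | (q 0) ^ 2 / a + (q 1) ^ 2 / b ≤ w ^ 2} :=
    measurableSet_le (by fun_prop) (by fun_prop)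
  change _ ≥ ∫ q in {q : Fin 2 → ℝ | (q 0) ^ 2 / a + (q 1) ^ 2 / b ≤ w ^ 2},
    1 / (δ + (q 0) ^ 2 / a + (q 1) ^ 2 / b)
  rw [← integral_indicator hEm]
  refine integral_mono_of_nonneg (Filter.Eventually.of_forall fun q => ?_)
    hint3.integral_prod_right ?_
  · refine Set.indicator_nonneg (fun q _ => ?_) q
    positivity
  have hnull : ∀ᵐ q : Fin 2 → ℝ, ¬ ((q 0) ^ 2 / a + (q 1) ^ 2 / b = w ^ 2) := by
    rw [ae_iff]
    simpa using neck_boundary_null a b w ha hb hw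
  filter_upwards [hnull] with q hq
  by_cases hqE : (q 0) ^ 2 / a + (q 1) ^ 2 / b ≤ w ^ 2
  · rw [Set.indicator_of_mem (by exact hqE)]
    have hlt := lt_of_le_of_ne hqE hq
    have hh : 0 < δ + (q 0) ^ 2 / a + (q 1) ^ 2 / b := by positivity
    have hTc : Continuous (fun z : ℝ => neckT (z, q)) := by
      unfold neckT
      refine (PiLp.continuous_toLp 2 _).comp (continuous_pi fun i => ?_)
      fin_cases i <;> simp <;> fun_prop
    have hmem : ∀ z, neckT (z, q) ∈ V ↔
        z ∈ Set.Ioo 0 (δ + (q 0) ^ 2 / a + (q 1) ^ 2 / b) := by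
      intro z
      simp [hV, neckT, hlt]
    have hseg : ∀ z ∈ Set.Icc 0 (δ + (q 0) ^ 2 / a + (q 1) ^ 2 / b), neckT (z, q) ∈ U := by
      intro z hz
      apply hcl
      rw [← closure_Ioo hh.ne] at hz
      exact map_mem_closure (f := fun z : ℝ => neckT (z, q)) hTc hz (fun y hy => (hmem y).2 hy)
    refine (neck_slice u U hU hu q _ hh hseg (h0 _ _ hqE) (h1 _ _ hqE)).trans (le_of_eq ?_)
    rw [← integral_indicator measurableSet_Ioo]
    congr 1
    funext z
    by_cases hz : z ∈ Set.Ioo 0 (δ + (q 0) ^ 2 / a + (q 1) ^ 2 / b)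
    · rw [Set.indicator_of_mem hz, Set.indicator_of_mem (by exact (hmem z).2 hz)]
    · rw [Set.indicator_of_notMem hz, Set.indicator_of_notMem (s := neckT ⁻¹' V)
        (fun h => hz ((hmem z).1 h))]
  · rw [Set.indicator_of_notMem (by exact hqE)]
    refine integral_nonneg fun z => Set.indicator_nonneg (fun _ _ => ?_) _
    positivity
end

section
/- Fix a > 0, b > 0 and w > 0. For δ ∈ (0,1) let ĥ_δ(x,y) = δ + x²/a + y²/b, let Π̂_δ = {(x,y,z) ∈ ℝ³ : x²/a + y²/b < w², 0 < z < ĥ_δ(x,y)}, and define G(δ) as the infimum of ∫_{Π̂_δ} ‖∇u‖² dx dy dz over all functions u : ℝ³ → ℝ that are continuously differentiable on an open set containing the closure of Π̂_δ and satisfy u(x,y,0) = 0 and u(x,y,ĥ_δ(x,y)) = 1 for all (x,y) with x²/a + y²/b ≤ w². Then G(δ)/log(1/δ) tends to π·√(a·b) as δ → 0⁺; equivalently, G(δ) = π·√(a·b)·|log δ|·(1 + o(1)) as δ → 0⁺. -/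
open MeasureTheory Real Filter

abbrev NkE := EuclideanSpace ℝ (Fin 3)

def nkPi (a b w δ : ℝ) : Set NkE := {p : EuclideanSpace ℝ (Fin 3) |
            (p 0) ^ 2 / a + (p 1) ^ 2 / b < w ^ 2 ∧
              0 < p 2 ∧ p 2 < δ + (p 0) ^ 2 / a + (p 1) ^ 2 / b}

def nkD (a b w : ℝ) : Set (ℝ × ℝ) := {q | q.1 ^ 2 / a + q.2 ^ 2 / b < w ^ 2}

noncomputable def nkJ (x y z : ℝ) : NkE := (WithLp.equiv 2 (Fin 3 → ℝ)).symm ![x, y, z]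

@[simp] lemma nkJ0 (x y z : ℝ) : (nkJ x y z) 0 = x := rfl
@[simp] lemma nkJ1 (x y z : ℝ) : (nkJ x y z) 1 = y := rfl
@[simp] lemma nkJ2 (x y z : ℝ) : (nkJ x y z) 2 = z := rfl

lemma nk_exists_equiv : ∃ e : NkE ≃ᵐ (ℝ × (ℝ × ℝ)), MeasurePreserving e volume volume ∧
    ∀ z x y, e.symm (z, (x, y)) = nkJ x y z := by
  have h1 := EuclideanSpace.volume_preserving_symm_measurableEquiv_toLp (Fin 3)
  have h2 := volume_preserving_piFinSuccAbove (fun _ : Fin 3 => ℝ) 2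
  have h3 := (MeasurePreserving.id (volume : Measure ℝ)).prod (volume_preserving_finTwoArrow ℝ)
  refine ⟨((MeasurableEquiv.toLp 2 (Fin 3 → ℝ)).symm.trans
    (MeasurableEquiv.piFinSuccAbove (fun _ : Fin 3 => ℝ) 2)).trans
    ((MeasurableEquiv.refl ℝ).prodCongr MeasurableEquiv.finTwoArrow),
    h3.comp (h2.comp h1), ?_⟩
  intro z x y
  rw [MeasurableEquiv.symm_apply_eq]
  rfl

lemma nk_isOpen_Pi (a b w δ : ℝ) : IsOpen (nkPi a b w δ) := by
  have h1 : IsOpen {p : NkE | (p 0) ^ 2 / a + (p 1) ^ 2 / b < w ^ 2} :=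
    isOpen_lt (by fun_prop) (by fun_prop)
  have h2 : IsOpen {p : NkE | 0 < p 2} := isOpen_lt (by fun_prop) (by fun_prop)
  have h3 : IsOpen {p : NkE | p 2 < δ + (p 0) ^ 2 / a + (p 1) ^ 2 / b} :=
    isOpen_lt (by fun_prop) (by fun_prop)
  exact h1.inter (h2.inter h3)

lemma nk_isOpen_D (a b w : ℝ) : IsOpen (nkD a b w) := by
  unfold nkD
  exact isOpen_lt (by fun_prop) (by fun_prop)

lemma nk_sq_le {a b w x y : ℝ} (ha : 0 < a) (hb : 0 < b) 
    (h : x ^ 2 / a + y ^ 2 / b < w ^ 2) : x ^ 2 ≤ a * w ^ 2 ∧ y ^ 2 ≤ b * w ^ 2 := by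
  have h1 : 0 ≤ x ^ 2 / a := by positivity
  have h2 : 0 ≤ y ^ 2 / b := by positivity
  have h3 : x ^ 2 / a ≤ w ^ 2 := by linarith
  have h4 : y ^ 2 / b ≤ w ^ 2 := by linarith
  rw [div_le_iff₀ ha] at h3
  rw [div_le_iff₀ hb] at h4
  constructor <;> linarith

lemma nk_compact {a b w δ : ℝ} (ha : 0 < a) (hb : 0 < b) (hδ : 0 < δ) :
    IsCompact (closure (nkPi a b w δ)) := by
  apply Bornology.IsBounded.isCompact_closure
  refine (Metric.isBounded_closedBall (x := (0 : NkE)) 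
    (r := √(a * w ^ 2 + b * w ^ 2 + (δ + w ^ 2) ^ 2))).subset ?_
  rintro p ⟨h1, h2, h3⟩
  rw [mem_closedBall_zero_iff]
  apply Real.le_sqrt_of_sq_le
  rw [EuclideanSpace.norm_sq_eq, Fin.sum_univ_three]
  simp only [Real.norm_eq_abs, sq_abs]
  obtain ⟨h4, h5⟩ := nk_sq_le ha hb h1
  have : p 2 ^ 2 ≤ (δ + w ^ 2) ^ 2 := by
    apply pow_le_pow_left₀ h2.le
    linarith
  linarith

lemma nk_D_finite {a b w : ℝ} (ha : 0 < a) (hb : 0 < b) : volume (nkD a b w) ≠ ⊤ := by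
  have : Bornology.IsBounded (nkD a b w) := by
    refine ((Metric.isBounded_Icc (-√(a * w ^ 2)) (√(a * w ^ 2))).prod 
      (Metric.isBounded_Icc (-√(b * w ^ 2)) (√(b * w ^ 2)))).subset ?_
    rintro ⟨x, y⟩ h
    obtain ⟨h4, h5⟩ := nk_sq_le ha hb h
    exact ⟨abs_le.1 (Real.abs_le_sqrt h4), abs_le.1 (Real.abs_le_sqrt h5)⟩
  exact this.measure_lt_top.ne

lemma nk_integrableOn {a b w δ : ℝ} (ha : 0 < a) (hb : 0 < b) (hδ : 0 < δ) {f : NkE → ℝ}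
    (hf : ContinuousOn f (closure (nkPi a b w δ))) : IntegrableOn f (nkPi a b w δ) :=
  (hf.integrableOn_compact (nk_compact ha hb hδ)).mono_set subset_closure

lemma nk_fubini {a b w δ : ℝ} (ha : 0 < a) (hb : 0 < b) (hδ : 0 < δ) {f : NkE → ℝ}
    (hf : ContinuousOn f (closure (nkPi a b w δ))) :
    ∫ p in nkPi a b w δ, f p =
      ∫ q in nkD a b w, ∫ z in (0:ℝ)..(δ + q.1 ^ 2 / a + q.2 ^ 2 / b), f (nkJ q.1 q.2 z) := by
  obtain ⟨e, he, hes⟩ := nk_exists_equiv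
  have hi := nk_integrableOn ha hb hδ hf
  rw [← integrable_indicator_iff (nk_isOpen_Pi a b w δ).measurableSet] at hi
  rw [← integral_indicator (nk_isOpen_Pi a b w δ).measurableSet,
    ← integral_indicator (nk_isOpen_D a b w).measurableSet]
  have he' := he.symm
  rw [← he'.integrable_comp_emb e.symm.measurableEmbedding] at hi
  rw [← he'.integral_comp e.symm.measurableEmbedding]
  rw [Measure.volume_eq_prod] at hi ⊢
  refine (integral_prod_symm _ hi).trans ?_
  congr 1
  ext ⟨x, y⟩
  simp only [Function.comp_apply, hes]
  by_cases hq : (x, y) ∈ nkD a b w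
  · rw [Set.indicator_of_mem hq]
    have h0 : 0 ≤ δ + x ^ 2 / a + y ^ 2 / b := by positivity
    rw [intervalIntegral.integral_of_le h0, integral_Ioc_eq_integral_Ioo,
      ← integral_indicator measurableSet_Ioo]
    congr 1
    ext z
    have hq' : x ^ 2 / a + y ^ 2 / b < w ^ 2 := hq
    by_cases hz : z ∈ Set.Ioo 0 (δ + x ^ 2 / a + y ^ 2 / b)
    · rw [Set.indicator_of_mem hz, Set.indicator_of_mem]
      exact ⟨hq', hz.1, hz.2⟩
    · rw [Set.indicator_of_notMem hz, Set.indicator_of_notMem]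
      rintro ⟨_, h2, h3⟩
      exact hz ⟨h2, h3⟩
  · rw [Set.indicator_of_notMem hq]
    have : ∀ z, (nkPi a b w δ).indicator f (nkJ x y z) = 0 := by
      intro z
      apply Set.indicator_of_notMem
      rintro ⟨h, _⟩
      exact hq h
    simp [this]

noncomputable def nkφ (w δ t : ℝ) : ℝ := if t < w ^ 2 then (δ + t)⁻¹ else 0

lemma nk_polar {w δ : ℝ} (hw : 0 < w) (hδ : 0 < δ) :
    ∫ q : ℝ × ℝ, nkφ w δ (q.1 ^ 2 + q.2 ^ 2) = π * Real.log ((δ + w ^ 2) / δ) := by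
  rw [← integral_comp_polarCoord_symm]
  have : ∀ p : ℝ × ℝ, p.1 • nkφ w δ ((polarCoord.symm p).1 ^ 2 + (polarCoord.symm p).2 ^ 2)
      = (p.1 * nkφ w δ (p.1 ^ 2)) * 1 := by
    intro p
    simp only [polarCoord_symm_apply, smul_eq_mul, mul_one]
    congr 2
    have := Real.sin_sq_add_cos_sq p.2
    linear_combination p.1 ^ 2 * this
  simp only [this]
  rw [polarCoord_target, Measure.volume_eq_prod,
    setIntegral_prod_mul (fun r => r * nkφ w δ (r ^ 2)) (fun _ => (1:ℝ))]
  have h1 : ∫ r in Set.Ioi (0:ℝ), r * nkφ w δ (r ^ 2) = ∫ r in (0:ℝ)..w, r * (δ + r ^ 2)⁻¹ := by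
    rw [intervalIntegral.integral_of_le hw.le, integral_Ioc_eq_integral_Ioo,
      ← integral_indicator measurableSet_Ioo, ← integral_indicator measurableSet_Ioi]
    congr 1
    ext r
    by_cases h0 : 0 < r
    · by_cases h2 : r < w
      · rw [Set.indicator_of_mem (by exact h0), Set.indicator_of_mem (by exact ⟨h0, h2⟩), nkφ,
          if_pos (by gcongr)]
      · rw [Set.indicator_of_mem (by exact h0), Set.indicator_of_notMem (by simp [h2]), nkφ, 
          if_neg (by push Not at h2 ⊢; gcongr), mul_zero]
    · rw [Set.indicator_of_notMem (by exact h0), Set.indicator_of_notMem (by simp [h0])]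
  have h2 : ∫ r in (0:ℝ)..w, r * (δ + r ^ 2)⁻¹ = Real.log (δ + w ^ 2) / 2 - Real.log (δ + 0 ^ 2) / 2 := by
    refine intervalIntegral.integral_eq_sub_of_hasDerivAt (f := fun r => Real.log (δ + r ^ 2) / 2) ?_ ?_
    · intro r _
      have h : HasDerivAt (fun r : ℝ => δ + r ^ 2) (2 * r) r := by
        simpa using (hasDerivAt_pow 2 r).const_add δ
      have hp : δ + r ^ 2 ≠ 0 := by positivity
      have h3 := (h.log hp).div_const 2
      have h4 : 2 * r / (δ + r ^ 2) / 2 = r * (δ + r ^ 2)⁻¹ := by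
        field_simp
      rw [h4] at h3
      exact h3
    · apply Continuous.intervalIntegrable
      have hp : ∀ r : ℝ, δ + r ^ 2 ≠ 0 := fun r => by positivity
      fun_prop (disch := exact hp _)
  rw [h1, h2, Real.log_div (by positivity) (by positivity)]
  simp
  rw [max_eq_left (by positivity)]
  ring

lemma nk_integrable {a b w δ : ℝ} (ha : 0 < a) (hb : 0 < b) (hδ : 0 < δ) :
    IntegrableOn (fun q : ℝ × ℝ => (δ + q.1 ^ 2 / a + q.2 ^ 2 / b)⁻¹) (nkD a b w) := by
  have hp : ∀ q : ℝ × ℝ, δ + q.1 ^ 2 / a + q.2 ^ 2 / b ≠ 0 := fun q => by positivity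
  refine Measure.integrableOn_of_bounded (M := δ⁻¹) (nk_D_finite ha hb) ?_ ?_
  · apply Continuous.aestronglyMeasurable
    fun_prop (disch := exact hp _)
  · refine Eventually.of_forall fun q => ?_
    have h1 : 0 ≤ q.1 ^ 2 / a + q.2 ^ 2 / b := by positivity
    rw [Real.norm_of_nonneg (by positivity)]
    apply inv_anti₀ hδ
    linarith

lemma nk_ind (a b w δ : ℝ) : (fun q : ℝ × ℝ => nkφ w δ (q.1 ^ 2 / a + q.2 ^ 2 / b)) = 
    (nkD a b w).indicator (fun q : ℝ × ℝ => (δ + q.1 ^ 2 / a + q.2 ^ 2 / b)⁻¹) := by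
  ext q
  simp only [nkφ, nkD, Set.indicator, Set.mem_ofPred_eq, add_assoc]

lemma nk_integrable' {a b w δ : ℝ} (ha : 0 < a) (hb : 0 < b) (hδ : 0 < δ) :
    Integrable (fun q : ℝ × ℝ => nkφ w δ (q.1 ^ 2 / a + q.2 ^ 2 / b)) := by
  rw [nk_ind, integrable_indicator_iff (nk_isOpen_D a b w).measurableSet]
  exact nk_integrable ha hb hδ

lemma nk_ellipse {a b w δ : ℝ} (ha : 0 < a) (hb : 0 < b) (hw : 0 < w) (hδ : 0 < δ) :
    ∫ q in nkD a b w, (δ + q.1 ^ 2 / a + q.2 ^ 2 / b)⁻¹ = 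
      √(a * b) * (π * Real.log ((δ + w ^ 2) / δ)) := by
  rw [← integral_indicator (nk_isOpen_D a b w).measurableSet, ← nk_ind, ← nk_polar hw hδ]
  have i1 := nk_integrable' (w := w) ha hb hδ
  have i2 : Integrable (fun q : ℝ × ℝ => nkφ w δ (q.1 ^ 2 + q.2 ^ 2)) := by
    simpa using nk_integrable' (w := w) one_pos one_pos hδ
  rw [Measure.volume_eq_prod] at *
  rw [integral_prod _ i1, integral_prod _ i2]
  have hsa := Real.sqrt_pos.2 ha
  have hsb := Real.sqrt_pos.2 hb
  have k1 : ∀ x, ∫ y, nkφ w δ (x ^ 2 / a + y ^ 2 / b) = √b * ∫ y, nkφ w δ (x ^ 2 / a + y ^ 2) := by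
    intro x
    have := Measure.integral_comp_mul_left (fun y => nkφ w δ (x ^ 2 / a + y ^ 2 / b)) (√b)
    simp only [mul_pow, Real.sq_sqrt hb.le] at this
    simp only [mul_div_cancel_left₀ _ hb.ne'] at this
    rw [this, abs_of_pos (by positivity), smul_eq_mul]
    field_simp
  simp only [k1]
  rw [integral_const_mul]
  have := Measure.integral_comp_mul_left (fun x => ∫ y, nkφ w δ (x ^ 2 / a + y ^ 2)) (√a)
  simp only [mul_pow, Real.sq_sqrt ha.le] at this
  simp only [mul_div_cancel_left₀ _ ha.ne'] at this
  rw [this, abs_of_pos (by positivity), smul_eq_mul, Real.sqrt_mul ha.le]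
  field_simp

lemma nk_lower {a b w δ : ℝ} (ha : 0 < a) (hb : 0 < b) (hδ : 0 < δ)
    {u : NkE → ℝ} {U : Set NkE} (hU : IsOpen U) (hsub : closure (nkPi a b w δ) ⊆ U)
    (hu : ContDiffOn ℝ 1 u U)
    (h0 : ∀ x y : ℝ, x ^ 2 / a + y ^ 2 / b ≤ w ^ 2 → u (nkJ x y 0) = 0)
    (h1 : ∀ x y : ℝ, x ^ 2 / a + y ^ 2 / b ≤ w ^ 2 → 
      u (nkJ x y (δ + x ^ 2 / a + y ^ 2 / b)) = 1) :
    ∫ q in nkD a b w, (δ + q.1 ^ 2 / a + q.2 ^ 2 / b)⁻¹ ≤ ∫ p in nkPi a b w δ, ‖gradient u p‖ ^ 2 := by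
  have hp : ∀ p : NkE, δ + p 0 ^ 2 / a + p 1 ^ 2 / b ≠ 0 := fun q => by positivity
  have hdf : ContinuousOn (fderiv ℝ u) (closure (nkPi a b w δ)) :=
    (hu.continuousOn_fderiv_of_isOpen hU le_rfl).mono hsub
  have hng : ∀ p, ‖gradient u p‖ = ‖fderiv ℝ u p‖ := fun p => by
    simp [gradient]
  set e2 : NkE := EuclideanSpace.single 2 1 with he2
  have hne2 : ‖e2‖ = 1 := by simp [he2]
  set H : NkE → ℝ := fun p => (δ + p 0 ^ 2 / a + p 1 ^ 2 / b)⁻¹ with hH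
  have hHc : Continuous H := by
    rw [hH]
    fun_prop (disch := exact hp _)
  have hc1 : ContinuousOn (fun p => fderiv ℝ u p e2) (closure (nkPi a b w δ)) :=
    hdf.clm_apply continuousOn_const
  have hc2 : ContinuousOn (fun p => 2 * (fderiv ℝ u p e2) * H p - H p ^ 2) 
      (closure (nkPi a b w δ)) := 
    ((continuousOn_const.mul hc1).mul hHc.continuousOn).sub (hHc.continuousOn.pow 2)
  have hc3 : ContinuousOn (fun p => ‖gradient u p‖ ^ 2) (closure (nkPi a b w δ)) := by
    simp only [hng]
    exact hdf.norm.pow 2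
  have hle : ∫ p in nkPi a b w δ, (2 * (fderiv ℝ u p e2) * H p - H p ^ 2) ≤ 
      ∫ p in nkPi a b w δ, ‖gradient u p‖ ^ 2 := by
    refine integral_mono (nk_integrableOn ha hb hδ hc2) (nk_integrableOn ha hb hδ hc3) ?_
    intro p
    have k1 : |fderiv ℝ u p e2| ≤ ‖gradient u p‖ := by
      have := (fderiv ℝ u p).le_opNorm e2
      rwa [hne2, mul_one, ← hng, Real.norm_eq_abs] at this
    have k2 : (fderiv ℝ u p e2) ^ 2 ≤ ‖gradient u p‖ ^ 2 := sq_le_sq.2 (by rwa [abs_norm])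
    simp only
    nlinarith [sq_nonneg (fderiv ℝ u p e2 - H p)]
  refine le_trans (le_of_eq ?_) hle
  rw [nk_fubini ha hb hδ hc2]
  apply setIntegral_congr_fun (nk_isOpen_D a b w).measurableSet
  rintro ⟨x, y⟩ hq
  have hq' : x ^ 2 / a + y ^ 2 / b < w ^ 2 := hq
  simp only
  set h := δ + x ^ 2 / a + y ^ 2 / b with hh
  have hpos : 0 < h := by positivity
  have hHJ : ∀ z, H (nkJ x y z) = h⁻¹ := fun z => rfl
  simp only [hHJ]
  have hJd : ∀ z, HasDerivAt (fun z => nkJ x y z) e2 z := by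
    intro z
    have : (fun z => nkJ x y z) = fun z : ℝ => nkJ x y 0 + z • e2 := by
      ext z i
      fin_cases i <;> simp [he2, nkJ]
    rw [this]
    simpa using ((hasDerivAt_id z).smul_const e2).const_add (nkJ x y 0)
  have hJc : Continuous (fun z => nkJ x y z) := 
    continuous_iff_continuousAt.2 fun z => (hJd z).continuousAt
  have hmem : ∀ z ∈ Set.Icc 0 h, nkJ x y z ∈ closure (nkPi a b w δ) := by
    intro z hz
    rw [← closure_Ioo hpos.ne] at hz
    exact map_mem_closure hJc hz fun z hz => ⟨hq', hz.1, hz.2⟩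
  have hint : IntervalIntegrable (fun z => fderiv ℝ u (nkJ x y z) e2) volume 0 h := by
    apply ContinuousOn.intervalIntegrable
    rw [Set.uIcc_of_le hpos.le]
    exact hc1.comp hJc.continuousOn hmem
  have hftc : ∫ z in (0:ℝ)..h, fderiv ℝ u (nkJ x y z) e2 = 1 := by
    rw [intervalIntegral.integral_eq_sub_of_hasDerivAt (f := fun z => u (nkJ x y z)) ?_ hint,
      h0 x y hq'.le, h1 x y hq'.le, sub_zero]
    intro z hz
    rw [Set.uIcc_of_le hpos.le] at hz
    have hUn := hU.mem_nhds (hsub (hmem z hz))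
    have hd := (hu.contDiffAt hUn).differentiableAt one_ne_zero
    exact hd.hasFDerivAt.comp_hasDerivAt z (hJd z)
  rw [intervalIntegral.integral_sub ((hint.const_mul 2).mul_const _) intervalIntegrable_const,
    intervalIntegral.integral_mul_const, intervalIntegral.integral_const_mul, hftc,
    intervalIntegral.integral_const, smul_eq_mul]
  field_simp
  ring

noncomputable def nku (a b δ : ℝ) (p : NkE) : ℝ := p 2 * (δ + p 0 ^ 2 / a + p 1 ^ 2 / b)⁻¹

lemma nku_contDiff {a b δ : ℝ} (ha : 0 < a) (hb : 0 < b) (hδ : 0 < δ) :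
    ContDiff ℝ 1 (nku a b δ) := by
  have hp : ∀ p : NkE, δ + p 0 ^ 2 / a + p 1 ^ 2 / b ≠ 0 := fun q => by positivity
  unfold nku
  fun_prop (disch := exact hp _)

lemma nku_grad {a b w δ : ℝ} (ha : 0 < a) (hb : 0 < b) (hδ : 0 < δ) (p : NkE) 
    (hpm : p ∈ nkPi a b w δ) : ‖gradient (nku a b δ) p‖ ^ 2 ≤ 
      ((δ + p 0 ^ 2 / a + p 1 ^ 2 / b)⁻¹) ^ 2 + 
       (4 / a + 4 / b) * (δ + p 0 ^ 2 / a + p 1 ^ 2 / b)⁻¹ := by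
  set h := δ + p 0 ^ 2 / a + p 1 ^ 2 / b with hh
  have hpos : 0 < h := by positivity
  let P : Fin 3 → NkE →L[ℝ] ℝ := fun i => EuclideanSpace.proj i
  have hP : ∀ i, HasFDerivAt (fun p : NkE => p i) (P i) p := fun i => (P i).hasFDerivAt
  have hd : HasFDerivAt (fun p : NkE => δ + p 0 ^ 2 / a + p 1 ^ 2 / b) 
      ((2 * p 0 / a) • P 0 + (2 * p 1 / b) • P 1) p := by
    have e0 := ((hP 0).pow 2).mul_const a⁻¹
    have e1 := ((hP 1).pow 2).mul_const b⁻¹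
    have := (e0.const_add δ).add e1
    refine HasFDerivAt.congr_fderiv (f := fun p : NkE => δ + p 0 ^ 2 / a + p 1 ^ 2 / b) this ?_
    ext v
    simp
    ring
  have hu : HasFDerivAt (nku a b δ) (h⁻¹ • P 2 - (p 2 * (h⁻¹) ^ 2) • ((2 * p 0 / a) • P 0 + (2 * p 1 / b) • P 1)) p := by
    have hi := (hasDerivAt_inv hpos.ne').comp_hasFDerivAt p hd
    have := (hP 2).mul hi
    refine HasFDerivAt.congr_fderiv (f := nku a b δ) this ?_
    ext v
    simp [hh]
    ring
  have hg : ∀ i, gradient (nku a b δ) p i = fderiv ℝ (nku a b δ) p (EuclideanSpace.single i 1) := by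
    intro i
    have : fderiv ℝ (nku a b δ) p (EuclideanSpace.single i 1) = inner ℝ (gradient (nku a b δ) p) (EuclideanSpace.single i 1) := by
      simp [gradient]
    rw [this, EuclideanSpace.inner_single_right]
    simp
  rw [EuclideanSpace.norm_sq_eq, Fin.sum_univ_three]
  simp only [hg, hu.fderiv, Real.norm_eq_abs, sq_abs]
  obtain ⟨-, z0, z1⟩ := hpm
  rw [← hh] at z1
  simp [P]
  have q1 : (p 2) ^ 2 ≤ h ^ 2 := by gcongr
  have q2 : p 0 ^ 2 / a ≤ h := by
    have : 0 ≤ p 1 ^ 2 / b := by positivity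
    linarith
  have q3 : p 1 ^ 2 / b ≤ h := by
    have : 0 ≤ p 0 ^ 2 / a := by positivity
    linarith
  have r1 : (p 2 * (h ^ 2)⁻¹ * (2 * p 0 / a)) ^ 2 ≤ 4 / a * h⁻¹ := by
    calc _ = (p 2) ^ 2 * (p 0 ^ 2 / a) * (4 / a * (h⁻¹) ^ 4) := by field_simp; ring
      _ ≤ h ^ 2 * h * (4 / a * (h⁻¹) ^ 4) := by gcongr
      _ = _ := by field_simp
  have r2 : (p 2 * (h ^ 2)⁻¹ * (2 * p 1 / b)) ^ 2 ≤ 4 / b * h⁻¹ := by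
    calc _ = (p 2) ^ 2 * (p 1 ^ 2 / b) * (4 / b * (h⁻¹) ^ 4) := by field_simp; ring
      _ ≤ h ^ 2 * h * (4 / b * (h⁻¹) ^ 4) := by gcongr
      _ = _ := by field_simp
  rw [← inv_pow] at *
  linarith

lemma nk_upper {a b w δ : ℝ} (ha : 0 < a) (hb : 0 < b) (hδ : 0 < δ) :
    ∫ p in nkPi a b w δ, ‖gradient (nku a b δ) p‖ ^ 2 ≤
     (∫ q in nkD a b w, (δ + q.1 ^ 2 / a + q.2 ^ 2 / b)⁻¹) + 
      (4 / a + 4 / b) * volume.real (nkD a b w) := by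
  have hp : ∀ p : NkE, δ + p 0 ^ 2 / a + p 1 ^ 2 / b ≠ 0 := fun q => by positivity
  have hc2 : Continuous (fun p : NkE => ((δ + p 0 ^ 2 / a + p 1 ^ 2 / b)⁻¹) ^ 2 + 
       (4 / a + 4 / b) * (δ + p 0 ^ 2 / a + p 1 ^ 2 / b)⁻¹) := by
    fun_prop (disch := exact hp _)
  have hng : ∀ p, ‖gradient (nku a b δ) p‖ = ‖fderiv ℝ (nku a b δ) p‖ := fun p => by
    simp [gradient]
  have hc3 : Continuous (fun p => ‖gradient (nku a b δ) p‖ ^ 2) := by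
    simp only [hng]
    exact ((nku_contDiff ha hb hδ).continuous_fderiv one_ne_zero).norm.pow 2
  refine (setIntegral_mono_on (nk_integrableOn ha hb hδ hc3.continuousOn) 
    (nk_integrableOn ha hb hδ hc2.continuousOn) (nk_isOpen_Pi a b w δ).measurableSet 
    (fun p hp => nku_grad ha hb hδ p hp)).trans (le_of_eq ?_)
  rw [nk_fubini ha hb hδ hc2.continuousOn]
  have : (4 / a + 4 / b) * volume.real (nkD a b w) = ∫ q in nkD a b w, (4 / a + 4 / b) := by
    rw [setIntegral_const, smul_eq_mul, mul_comm]
  rw [this, ← integral_add (nk_integrable ha hb hδ) (integrableOn_const (nk_D_finite ha hb))]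
  congr 1
  ext q
  simp only [nkJ0, nkJ1]
  rw [intervalIntegral.integral_const, smul_eq_mul]
  have : δ + q.1 ^ 2 / a + q.2 ^ 2 / b ≠ 0 := by positivity
  generalize δ + q.1 ^ 2 / a + q.2 ^ 2 / b = h at *
  field_simp
  ring

lemma nk_limit (c w K : ℝ) (hw : 0 < w) : 
    Tendsto (fun δ : ℝ => (c * (π * Real.log ((δ + w ^ 2) / δ)) + K) / Real.log (1 / δ))
      (nhdsWithin 0 (Set.Ioi 0)) (nhds (π * c)) := by
  have hl : Tendsto (fun δ : ℝ => Real.log (1 / δ)) (nhdsWithin 0 (Set.Ioi 0)) atTop := by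
    simp only [one_div]
    exact Real.tendsto_log_atTop.comp tendsto_inv_nhdsGT_zero
  have h1 : Tendsto (fun δ : ℝ => c * π * Real.log (δ + w ^ 2) + K) (nhdsWithin 0 (Set.Ioi 0))
      (nhds (c * π * Real.log (0 + w ^ 2) + K)) := by
    have : ContinuousAt (fun δ : ℝ => c * π * Real.log (δ + w ^ 2) + K) 0 := by
      have : (0:ℝ) + w ^ 2 ≠ 0 := by positivity
      fun_prop (disch := exact this)
    exact this.tendsto.mono_left nhdsWithin_le_nhds
  have h2 := (h1.div_atTop hl).const_add (π * c)
  rw [add_zero] at h2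
  refine h2.congr' ?_
  filter_upwards [hl.eventually_gt_atTop 0, self_mem_nhdsWithin] with δ hδ hδ0
  have hδ0' : 0 < δ := hδ0
  rw [one_div, Real.log_inv] at *
  rw [Real.log_div (by positivity) hδ0'.ne']
  have : Real.log δ ≠ 0 := (by linarith : Real.log δ < 0).ne
  field_simp
  ring


/-- Blow-up of the 3D model neck energy: with `ĥ_δ(x,y) = δ + x²/a + y²/b`,
`Π̂_δ = {x²/a + y²/b < w², 0 < z < ĥ_δ(x,y)}`, and `G(δ)` the infimum of the Dirichlet
energy `∫_{Π̂_δ} ‖∇u‖²` over all `u` that are `C¹` on an open neighborhood of the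
closure of `Π̂_δ` with `u = 0` on the lower cap and `u = 1` on the upper cap, one has
`G(δ) / log(1/δ) → π √(ab)` as `δ → 0⁺`. -/
theorem neck_energy_blowup_3d (a b w : ℝ) (ha : 0 < a) (hb : 0 < b) (hw : 0 < w)
    (G : ℝ → ℝ)
    (hG : ∀ δ : ℝ, δ ∈ Set.Ioo (0 : ℝ) 1 →
      G δ = sInf {e : ℝ |
        ∃ (u : EuclideanSpace ℝ (Fin 3) → ℝ) (U : Set (EuclideanSpace ℝ (Fin 3))),
          IsOpen U ∧
          closure {p : EuclideanSpace ℝ (Fin 3) |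
            (p 0) ^ 2 / a + (p 1) ^ 2 / b < w ^ 2 ∧
              0 < p 2 ∧ p 2 < δ + (p 0) ^ 2 / a + (p 1) ^ 2 / b} ⊆ U ∧
          ContDiffOn ℝ 1 u U ∧
          (∀ x y : ℝ, x ^ 2 / a + y ^ 2 / b ≤ w ^ 2 →
            u ((WithLp.equiv 2 (Fin 3 → ℝ)).symm ![x, y, 0]) = 0) ∧
          (∀ x y : ℝ, x ^ 2 / a + y ^ 2 / b ≤ w ^ 2 →
            u ((WithLp.equiv 2 (Fin 3 → ℝ)).symm
              ![x, y, δ + x ^ 2 / a + y ^ 2 / b]) = 1) ∧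
          e = ∫ p in {p : EuclideanSpace ℝ (Fin 3) |
              (p 0) ^ 2 / a + (p 1) ^ 2 / b < w ^ 2 ∧
                0 < p 2 ∧ p 2 < δ + (p 0) ^ 2 / a + (p 1) ^ 2 / b},
              ‖gradient u p‖ ^ 2}) :
    Tendsto (fun δ : ℝ => G δ / Real.log (1 / δ))
      (nhdsWithin 0 (Set.Ioi 0)) (nhds (Real.pi * Real.sqrt (a * b))) := by
  have key : ∀ δ : ℝ, δ ∈ Set.Ioo (0 : ℝ) 1 →
      √(a * b) * (π * Real.log ((δ + w ^ 2) / δ)) ≤ G δ ∧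
      G δ ≤ √(a * b) * (π * Real.log ((δ + w ^ 2) / δ)) + 
        (4 / a + 4 / b) * volume.real (nkD a b w) := by
    intro δ hδ
    rw [hG δ hδ]
    have hδ0 := hδ.1
    have hlow : ∀ e ∈ {e : ℝ | ∃ (u : NkE → ℝ) (U : Set NkE),
          IsOpen U ∧ closure (nkPi a b w δ) ⊆ U ∧ ContDiffOn ℝ 1 u U ∧
          (∀ x y : ℝ, x ^ 2 / a + y ^ 2 / b ≤ w ^ 2 → u (nkJ x y 0) = 0) ∧
          (∀ x y : ℝ, x ^ 2 / a + y ^ 2 / b ≤ w ^ 2 →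
            u (nkJ x y (δ + x ^ 2 / a + y ^ 2 / b)) = 1) ∧
          e = ∫ p in nkPi a b w δ, ‖gradient u p‖ ^ 2}, 
        √(a * b) * (π * Real.log ((δ + w ^ 2) / δ)) ≤ e := by
      rintro e ⟨u, U, hU, hsub, hu, h0, h1, rfl⟩
      rw [← nk_ellipse ha hb hw hδ0]
      exact nk_lower ha hb hδ0 hU hsub hu h0 h1
    have hmem : (∫ p in nkPi a b w δ, ‖gradient (nku a b δ) p‖ ^ 2) ∈ 
        {e : ℝ | ∃ (u : NkE → ℝ) (U : Set NkE),
          IsOpen U ∧ closure (nkPi a b w δ) ⊆ U ∧ ContDiffOn ℝ 1 u U ∧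
          (∀ x y : ℝ, x ^ 2 / a + y ^ 2 / b ≤ w ^ 2 → u (nkJ x y 0) = 0) ∧
          (∀ x y : ℝ, x ^ 2 / a + y ^ 2 / b ≤ w ^ 2 →
            u (nkJ x y (δ + x ^ 2 / a + y ^ 2 / b)) = 1) ∧
          e = ∫ p in nkPi a b w δ, ‖gradient u p‖ ^ 2} := by
      refine ⟨nku a b δ, Set.univ, isOpen_univ, Set.subset_univ _, 
        (nku_contDiff ha hb hδ0).contDiffOn, ?_, ?_, rfl⟩
      · intro x y _
        simp [nku]
      · intro x y _
        have : δ + x ^ 2 / a + y ^ 2 / b ≠ 0 := by positivity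
        simp only [nku, nkJ0, nkJ1, nkJ2]
        exact mul_inv_cancel₀ this
    refine ⟨le_csInf ⟨_, hmem⟩ hlow, (csInf_le ⟨_, hlow⟩ hmem).trans ?_⟩
    rw [← nk_ellipse ha hb hw hδ0]
    exact nk_upper ha hb hδ0
  have hev : ∀ᶠ δ in nhdsWithin (0:ℝ) (Set.Ioi 0), δ ∈ Set.Ioo (0:ℝ) 1 :=
    Ioo_mem_nhdsGT one_pos
  refine tendsto_of_tendsto_of_tendsto_of_le_of_le' (nk_limit (√(a * b)) w 0 hw) 
    (nk_limit (√(a * b)) w ((4 / a + 4 / b) * volume.real (nkD a b w)) hw) ?_ ?_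
  · filter_upwards [hev] with δ hδ
    have : 0 ≤ Real.log (1 / δ) := Real.log_nonneg (by rw [le_div_iff₀ hδ.1]; linarith [hδ.2])
    rw [add_zero]
    exact div_le_div_of_nonneg_right (key δ hδ).1 this
  · filter_upwards [hev] with δ hδ
    have : 0 ≤ Real.log (1 / δ) := Real.log_nonneg (by rw [le_div_iff₀ hδ.1]; linarith [hδ.2])
    exact div_le_div_of_nonneg_right (key δ hδ).2 this
end

section
/- Fix α > 0 and w > 0. For δ > 0 let h_δ(x) = δ + x²/α, Π_δ = {(x,y) ∈ ℝ² : |x| < w, 0 < y < h_δ(x)}, and φ_δ(x,y) = y/h_δ(x). Then for every δ > 0 one has 1/δ ≤ sup_{(x,y) ∈ Π_δ} ‖∇φ_δ(x,y)‖ ≤ (1/δ)·√(1 + δ/α); in particular, δ · sup_{(x,y) ∈ Π_δ} ‖∇φ_δ(x,y)‖ → 1 as δ → 0⁺. -/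
open MeasureTheory Real Filter

theorem keller_aux_norm (α δ : ℝ) (hα : 0 < α) (hδ : 0 < δ) (p : EuclideanSpace ℝ (Fin 2)) :
    ‖gradient (fun q : EuclideanSpace ℝ (Fin 2) => q 1 / (δ + (q 0) ^ 2 / α)) p‖ =
      Real.sqrt ((p 1 * (2 * p 0 / α) / (δ + (p 0) ^ 2 / α) ^ 2) ^ 2
        + (1 / (δ + (p 0) ^ 2 / α)) ^ 2) := by
  have hh : 0 < δ + (p 0) ^ 2 / α := by positivity
  have h0 : HasFDerivAt (fun q : EuclideanSpace ℝ (Fin 2) => q 0)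
      (EuclideanSpace.proj 0 : EuclideanSpace ℝ (Fin 2) →L[ℝ] ℝ) p :=
    (EuclideanSpace.proj 0 : EuclideanSpace ℝ (Fin 2) →L[ℝ] ℝ).hasFDerivAt
  have h1 : HasFDerivAt (fun q : EuclideanSpace ℝ (Fin 2) => q 1)
      (EuclideanSpace.proj 1 : EuclideanSpace ℝ (Fin 2) →L[ℝ] ℝ) p :=
    (EuclideanSpace.proj 1 : EuclideanSpace ℝ (Fin 2) →L[ℝ] ℝ).hasFDerivAt
  have hd : HasDerivAt (fun x : ℝ => (δ + x ^ 2 / α)⁻¹)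
      (-(2 * p 0 / α) / (δ + (p 0) ^ 2 / α) ^ 2) (p 0) := by
    have := ((((hasDerivAt_id (p 0)).pow 2).div_const α).const_add δ).inv hh.ne'
    refine HasDerivAt.congr_deriv this ?_
    simp
  have hi := hd.comp_hasFDerivAt p h0
  have hm := h1.mul hi
  have hg : HasGradientAt (fun q : EuclideanSpace ℝ (Fin 2) => q 1 / (δ + (q 0) ^ 2 / α))
      (!₂[-(p 1 * (2 * p 0 / α) / (δ + (p 0) ^ 2 / α) ^ 2), 1 / (δ + (p 0) ^ 2 / α)]) p := by
    rw [hasGradientAt_iff_hasFDerivAt]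
    refine (hm.congr_fderiv ?_)
    ext v
    simp [PiLp.inner_apply, Fin.sum_univ_two]
    ring
  rw [hg.gradient, EuclideanSpace.norm_eq]
  simp [Fin.sum_univ_two]

theorem keller_aux_le (α δ : ℝ) (hα : 0 < α) (hδ : 0 < δ) (p : EuclideanSpace ℝ (Fin 2))
    (hp : 0 < p 1) (hp' : p 1 < δ + (p 0) ^ 2 / α) :
    ‖gradient (fun q : EuclideanSpace ℝ (Fin 2) => q 1 / (δ + (q 0) ^ 2 / α)) p‖ ≤
      1 / δ * Real.sqrt (1 + δ / α) := by
  rw [keller_aux_norm α δ hα hδ p]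
  have e : 1 / δ * Real.sqrt (1 + δ / α) = Real.sqrt ((1 / δ) ^ 2 * (1 + δ / α)) := by
    rw [Real.sqrt_mul (by positivity), Real.sqrt_sq (by positivity)]
  rw [e]
  apply Real.sqrt_le_sqrt
  generalize p 0 = x at *
  generalize p 1 = y at *
  obtain ⟨h, hh⟩ : ∃ h, h = δ + x ^ 2 / α := ⟨_, rfl⟩
  rw [← hh] at hp' ⊢
  have hx : x ^ 2 = α * (h - δ) := by rw [hh]; field_simp; ring
  have hδh : δ ≤ h := by rw [hh]; have : 0 ≤ x ^ 2 / α := by positivity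
                         linarith
  have hpos : 0 < h := by linarith
  have a1 : (y * (2 * x / α) / h ^ 2) ^ 2 ≤ 1 / (δ * α) := by
    have : (y * (2 * x / α) / h ^ 2) ^ 2 = y ^ 2 * (4 * (h - δ)) / (α * h ^ 4) := by
      have : (y * (2 * x / α) / h ^ 2) ^ 2 = y ^ 2 * 4 * x ^ 2 / (α ^ 2 * h ^ 4) := by
        field_simp; ring
      rw [this, hx]; field_simp
    rw [this]
    have hy : y ^ 2 ≤ h ^ 2 := by gcongr
    calc y ^ 2 * (4 * (h - δ)) / (α * h ^ 4) ≤ h ^ 2 * (4 * (h - δ)) / (α * h ^ 4) := by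
          have : 0 ≤ h - δ := by linarith
          gcongr
      _ = 4 * (h - δ) / (α * h ^ 2) := by field_simp
      _ ≤ 1 / (δ * α) := by
          rw [div_le_div_iff₀ (by positivity) (by positivity)]
          nlinarith [mul_nonneg hα.le (sq_nonneg (h - 2 * δ))]
  have a2 : (1 / h) ^ 2 ≤ (1 / δ) ^ 2 := by gcongr
  have : (1 / δ) ^ 2 * (1 + δ / α) = 1 / (δ * α) + (1 / δ) ^ 2 := by field_simp; ring
  linarith

/-- Blow-up of the gradient of the 2D Keller test function `φ_δ(x,y) = y/h_δ(x)` over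
the model neck `Π_δ = {|x| < w, 0 < y < h_δ(x)}` with `h_δ(x) = δ + x²/α`:
for every `δ > 0`, `1/δ ≤ sup_{Π_δ} ‖∇φ_δ‖ ≤ (1/δ)√(1 + δ/α)`; in particular
`δ · sup_{Π_δ} ‖∇φ_δ‖ → 1` as `δ → 0⁺`. -/
theorem keller_gradient_blowup_2d (α w : ℝ) (hα : 0 < α) (hw : 0 < w) :
    (∀ δ : ℝ, 0 < δ →
      1 / δ ≤
          sSup ((fun p : EuclideanSpace ℝ (Fin 2) =>
              ‖gradient (fun q : EuclideanSpace ℝ (Fin 2) =>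
                q 1 / (δ + (q 0) ^ 2 / α)) p‖) ''
            {p : EuclideanSpace ℝ (Fin 2) |
              |p 0| < w ∧ 0 < p 1 ∧ p 1 < δ + (p 0) ^ 2 / α}) ∧
        sSup ((fun p : EuclideanSpace ℝ (Fin 2) =>
              ‖gradient (fun q : EuclideanSpace ℝ (Fin 2) =>
                q 1 / (δ + (q 0) ^ 2 / α)) p‖) ''
            {p : EuclideanSpace ℝ (Fin 2) |
              |p 0| < w ∧ 0 < p 1 ∧ p 1 < δ + (p 0) ^ 2 / α}) ≤
          1 / δ * Real.sqrt (1 + δ / α)) ∧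
      Tendsto (fun δ : ℝ =>
          δ * sSup ((fun p : EuclideanSpace ℝ (Fin 2) =>
              ‖gradient (fun q : EuclideanSpace ℝ (Fin 2) =>
                q 1 / (δ + (q 0) ^ 2 / α)) p‖) ''
            {p : EuclideanSpace ℝ (Fin 2) |
              |p 0| < w ∧ 0 < p 1 ∧ p 1 < δ + (p 0) ^ 2 / α}))
        (nhdsWithin 0 (Set.Ioi 0)) (nhds 1) := by
  have key : ∀ δ : ℝ, 0 < δ → 1 / δ ≤
          sSup ((fun p : EuclideanSpace ℝ (Fin 2) =>
              ‖gradient (fun q : EuclideanSpace ℝ (Fin 2) =>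
                q 1 / (δ + (q 0) ^ 2 / α)) p‖) ''
            {p : EuclideanSpace ℝ (Fin 2) |
              |p 0| < w ∧ 0 < p 1 ∧ p 1 < δ + (p 0) ^ 2 / α}) ∧
        sSup ((fun p : EuclideanSpace ℝ (Fin 2) =>
              ‖gradient (fun q : EuclideanSpace ℝ (Fin 2) =>
                q 1 / (δ + (q 0) ^ 2 / α)) p‖) ''
            {p : EuclideanSpace ℝ (Fin 2) |
              |p 0| < w ∧ 0 < p 1 ∧ p 1 < δ + (p 0) ^ 2 / α}) ≤
          1 / δ * Real.sqrt (1 + δ / α) := by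
    intro δ hδ
    have hmem : (!₂[0, δ / 2] : EuclideanSpace ℝ (Fin 2)) ∈ {p : EuclideanSpace ℝ (Fin 2) |
              |p 0| < w ∧ 0 < p 1 ∧ p 1 < δ + (p 0) ^ 2 / α} := by
      simp [hw, hδ]
    constructor
    · apply le_csSup
      · refine ⟨1 / δ * Real.sqrt (1 + δ / α), ?_⟩
        rintro _ ⟨p, hp, rfl⟩
        exact keller_aux_le α δ hα hδ p hp.2.1 hp.2.2
      · refine ⟨_, hmem, ?_⟩
        simp only []
        rw [keller_aux_norm α δ hα hδ]
        have : 0 ≤ δ⁻¹ := by positivity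
        simp [abs_of_pos hδ, Real.sqrt_sq this, ← inv_pow]
    · refine csSup_le (Set.Nonempty.image _ ⟨_, hmem⟩) ?_
      rintro _ ⟨p, hp, rfl⟩
      exact keller_aux_le α δ hα hδ p hp.2.1 hp.2.2
  refine ⟨key, ?_⟩
  have hlim : Tendsto (fun δ : ℝ => Real.sqrt (1 + δ / α)) (nhdsWithin 0 (Set.Ioi 0)) (nhds 1) := by
    have : Continuous (fun δ : ℝ => Real.sqrt (1 + δ / α)) := by fun_prop
    have := (this.tendsto 0).mono_left (nhdsWithin_le_nhds (s := Set.Ioi 0))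
    simpa using this
  refine tendsto_of_tendsto_of_tendsto_of_le_of_le' tendsto_const_nhds hlim ?_ ?_
  · filter_upwards [self_mem_nhdsWithin] with δ hδ
    have hδ : 0 < δ := hδ
    have := mul_le_mul_of_nonneg_left (key δ hδ).1 hδ.le
    rwa [mul_one_div_cancel hδ.ne'] at this
  · filter_upwards [self_mem_nhdsWithin] with δ hδ
    have hδ : 0 < δ := hδ
    have := mul_le_mul_of_nonneg_left (key δ hδ).2 hδ.le
    rwa [← mul_assoc, mul_one_div_cancel hδ.ne', one_mul] at this
end

section
/- Fix α > 0, w > 0, δ > 0 and a real exponent p ≥ 2, and let h_δ(x) = δ + x²/α and Π_δ = {(x,y) ∈ ℝ² : |x| < w, 0 < y < h_δ(x)}. Let u : ℝ² → ℝ be continuously differentiable on an open set containing the closure of Π_δ and satisfy u(x, 0) = 0 and u(x, h_δ(x)) = 1 for all x ∈ [−w, w]. Then ∫_{Π_δ} ‖∇u(x,y)‖^p dx dy ≥ ∫_{−w}^{w} h_δ(x)^{1−p} dx. -/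
open MeasureTheory Real

lemma aux_tangent (h t s p : ℝ) (hh : 0 < h) (ht : 0 ≤ t) (hs : s ≤ t) (hp : 2 ≤ p) :
    (1 - p) * h ^ (-p) + p * h ^ (1 - p) * s ≤ t ^ p := by
  have h1 := one_add_mul_self_le_rpow_one_add (s := t * h - 1) (p := p)
    (by nlinarith [mul_nonneg ht hh.le]) (by linarith)
  have e : (1 + (t * h - 1)) = t * h := by ring
  rw [e, Real.mul_rpow ht hh.le] at h1
  have hpos : 0 < h ^ (-p) := Real.rpow_pos_of_pos hh _
  have h2 : h ^ (1 - p) = h * h ^ (-p) := by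
    rw [sub_eq_add_neg, Real.rpow_add hh, Real.rpow_one]
  have h3 : h ^ p * h ^ (-p) = 1 := by
    rw [← Real.rpow_add hh]; simp
  have h4 := mul_le_mul_of_nonneg_right h1 hpos.le
  rw [mul_assoc, h3] at h4
  have h5 : p * h ^ (1 - p) * s ≤ p * h ^ (1 - p) * t :=
    mul_le_mul_of_nonneg_left hs (by rw [h2]; positivity)
  have h6 : p * h ^ (1 - p) * t = p * (h * h ^ (-p)) * t := by rw [h2]
  nlinarith

/-- The chart. -/
noncomputable def auxE : ℝ × ℝ ≃ᵐ EuclideanSpace ℝ (Fin 2) :=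
  (MeasurableEquiv.finTwoArrow (α := ℝ)).symm.trans (MeasurableEquiv.toLp 2 (Fin 2 → ℝ))

lemma auxE_apply (x y : ℝ) : auxE (x, y) = WithLp.toLp 2 ![x, y] := rfl

lemma auxE_mp : MeasurePreserving auxE volume volume :=
  (EuclideanSpace.volume_preserving_symm_measurableEquiv_toLp (Fin 2)).symm.comp
    (volume_preserving_finTwoArrow ℝ).symm

lemma aux_line (x y : ℝ) : HasDerivAt (fun y : ℝ => (WithLp.toLp 2 ![x, y] : EuclideanSpace ℝ (Fin 2)))
    (WithLp.toLp 2 ![0, 1]) y := by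
  have : (fun y : ℝ => (WithLp.toLp 2 ![x, y] : EuclideanSpace ℝ (Fin 2))) =
      fun y => (WithLp.toLp 2 ![x, 0] : EuclideanSpace ℝ (Fin 2)) + y • WithLp.toLp 2 ![0, 1] := by
    ext y i
    fin_cases i <;> simp
  rw [this]
  simpa using ((hasDerivAt_id y).smul_const
    (WithLp.toLp 2 ![0, 1] : EuclideanSpace ℝ (Fin 2))).const_add (WithLp.toLp 2 ![x, 0])

/-- p-Laplacian lower variational bound for the 2D neck energy: if `p ≥ 2` and `u` is
`C¹` on an open set containing the closure of the model neck
`Π_δ = {|x| < w, 0 < y < h_δ(x)}` with `h_δ(x) = δ + x²/α`, `u = 0` on the lower arc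
and `u = 1` on the upper arc, then `∫_{Π_δ} ‖∇u‖^p ≥ ∫_{-w}^{w} h_δ(x)^{1-p} dx`. -/
theorem neck_energy_lower_bound_2d_pLaplacian (α w δ p : ℝ)
    (hα : 0 < α) (hw : 0 < w) (hδ : 0 < δ) (hp : 2 ≤ p)
    (u : EuclideanSpace ℝ (Fin 2) → ℝ) (U : Set (EuclideanSpace ℝ (Fin 2)))
    (hU : IsOpen U)
    (hcl : closure {q : EuclideanSpace ℝ (Fin 2) |
      |q 0| < w ∧ 0 < q 1 ∧ q 1 < δ + (q 0) ^ 2 / α} ⊆ U)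
    (hu : ContDiffOn ℝ 1 u U)
    (h0 : ∀ x ∈ Set.Icc (-w) w,
      u ((WithLp.equiv 2 (Fin 2 → ℝ)).symm ![x, 0]) = 0)
    (h1 : ∀ x ∈ Set.Icc (-w) w,
      u ((WithLp.equiv 2 (Fin 2 → ℝ)).symm ![x, δ + x ^ 2 / α]) = 1) :
    (∫ q in {q : EuclideanSpace ℝ (Fin 2) |
        |q 0| < w ∧ 0 < q 1 ∧ q 1 < δ + (q 0) ^ 2 / α},
        ‖gradient u q‖ ^ p) ≥
      ∫ x in (-w)..w, (δ + x ^ 2 / α) ^ (1 - p) := by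
  set Pi : Set (EuclideanSpace ℝ (Fin 2)) := {q : EuclideanSpace ℝ (Fin 2) |
      |q 0| < w ∧ 0 < q 1 ∧ q 1 < δ + (q 0) ^ 2 / α} with hPi
  set h : ℝ → ℝ := fun x => δ + x ^ 2 / α with hh
  have hpos : ∀ x, 0 < h x := fun x => by simp only [hh]; positivity
  have hcont : Continuous h := by simp only [hh]; fun_prop
  have c0 : Continuous fun q : EuclideanSpace ℝ (Fin 2) => q 0 := by fun_prop
  have c1 : Continuous fun q : EuclideanSpace ℝ (Fin 2) => q 1 := by fun_prop
  have hPo : IsOpen Pi := by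
    exact (isOpen_lt c0.abs continuous_const).inter
      ((isOpen_lt continuous_const c1).inter (isOpen_lt c1 (hcont.comp c0)))
  have hPm : MeasurableSet Pi := hPo.measurableSet
  have hPb : Bornology.IsBounded Pi := by
    refine (Metric.isBounded_closedBall (x := (0 : EuclideanSpace ℝ (Fin 2)))
      (r := w + (δ + w ^ 2 / α))).subset ?_
    rintro q ⟨a, b, c⟩
    rw [mem_closedBall_zero_iff, EuclideanSpace.norm_eq]
    apply Real.sqrt_le_iff.2
    have h2 : (q 0) ^ 2 ≤ w ^ 2 := sq_le_sq' (by linarith [(abs_lt.1 a).1]) (abs_lt.1 a).2.le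
    have h3 : q 1 ≤ δ + w ^ 2 / α := c.le.trans (by gcongr)
    have h4 : 0 < δ + w ^ 2 / α := by positivity
    refine ⟨by positivity, ?_⟩
    simp only [Fin.sum_univ_two, Real.norm_eq_abs, sq_abs]
    nlinarith
  have hK : IsCompact (closure Pi) := hPb.isCompact_closure
  set e : EuclideanSpace ℝ (Fin 2) := WithLp.toLp 2 ![0, 1] with he
  have hen : ‖e‖ = 1 := by simp [he, EuclideanSpace.norm_eq]
  have hfd : ContinuousOn (fderiv ℝ u) U := hu.continuousOn_fderiv_of_isOpen hU le_rfl
  have hgn : ∀ q, ‖gradient u q‖ = ‖fderiv ℝ u q‖ := fun q => by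
    simp [gradient]
  simp only [hgn]
  set G : EuclideanSpace ℝ (Fin 2) → ℝ := fun q =>
    (1 - p) * h (q 0) ^ (-p) + p * h (q 0) ^ (1 - p) * fderiv ℝ u q e with hG
  have hGc : ContinuousOn G U := by
    have a1 : ∀ r : ℝ, Continuous fun q : EuclideanSpace ℝ (Fin 2) => h (q 0) ^ r := fun r =>
      (hcont.comp c0).rpow_const fun q => Or.inl (hpos _).ne'
    exact (continuous_const.mul (a1 _)).continuousOn.add
      ((continuous_const.mul (a1 _)).continuousOn.mul (hfd.clm_apply continuousOn_const))
  have hGi : IntegrableOn G Pi :=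
    ((hGc.mono hcl).integrableOn_compact hK).mono_set subset_closure
  have hFi : IntegrableOn (fun q => ‖fderiv ℝ u q‖ ^ p) Pi :=
    (((hfd.norm.rpow_const fun q _ => Or.inr (by linarith)).mono hcl).integrableOn_compact
      hK).mono_set subset_closure
  have hle : ∫ q in Pi, G q ≤ ∫ q in Pi, ‖fderiv ℝ u q‖ ^ p := by
    apply setIntegral_mono hGi hFi
    intro q
    apply aux_tangent _ _ _ _ (hpos _) (norm_nonneg _) _ hp
    calc fderiv ℝ u q e ≤ ‖fderiv ℝ u q e‖ := le_abs_self _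
      _ ≤ ‖fderiv ℝ u q‖ * ‖e‖ := ContinuousLinearMap.le_opNorm _ _
      _ = _ := by rw [hen, mul_one]
  refine ge_iff_le.2 (le_trans (le_of_eq ?_) hle)
  have hpre : auxE ⁻¹' Pi = regionBetween (fun _ => 0) h (Set.Ioo (-w) w) := by
    ext ⟨x, y⟩
    simp [hPi, auxE_apply, regionBetween, abs_lt, hh]
  have hGi2 : Integrable ((auxE ⁻¹' Pi).indicator (fun z => G (auxE z))) (volume.prod volume) := by
    rw [integrable_indicator_iff (auxE.measurable hPm)]
    exact (auxE_mp.integrableOn_comp_preimage auxE.measurableEmbedding).2 hGi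
  rw [← auxE_mp.setIntegral_preimage_emb auxE.measurableEmbedding,
    ← integral_indicator (auxE.measurable hPm), Measure.volume_eq_prod, integral_prod _ hGi2]
  rw [intervalIntegral.integral_of_le (by linarith), integral_Ioc_eq_integral_Ioo,
    ← integral_indicator measurableSet_Ioo]
  congr 1
  ext x
  by_cases hx : x ∈ Set.Ioo (-w) w
  · rw [Set.indicator_of_mem hx]
    have e1 : ∀ y, (auxE ⁻¹' Pi).indicator (fun z => G (auxE z)) (x, y) =
        (Set.Ioo 0 (h x)).indicator (fun y => G (WithLp.toLp 2 ![x, y])) y := by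
      intro y
      have : (x, y) ∈ auxE ⁻¹' Pi ↔ y ∈ Set.Ioo 0 (h x) := by
        rw [hpre]; simp only [regionBetween, Set.mem_ofPred_eq, hx, true_and]
      by_cases hy : y ∈ Set.Ioo 0 (h x)
      · rw [Set.indicator_of_mem hy, Set.indicator_of_mem (this.2 hy), auxE_apply]
      · rw [Set.indicator_of_notMem hy, Set.indicator_of_notMem (fun H => hy (this.1 H))]
    simp only [e1]
    rw [integral_indicator measurableSet_Ioo, ← integral_Ioc_eq_integral_Ioo,
      ← intervalIntegral.integral_of_le (hpos x).le]
    have hlc : Continuous fun y : ℝ => (WithLp.toLp 2 ![x, y] : EuclideanSpace ℝ (Fin 2)) :=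
      continuous_iff_continuousAt.2 fun y => (aux_line x y).continuousAt
    have hmem : ∀ y ∈ Set.uIcc 0 (h x), (WithLp.toLp 2 ![x, y] : EuclideanSpace ℝ (Fin 2)) ∈ U := by
      intro y hy
      rw [Set.uIcc_of_le (hpos x).le, ← closure_Ioo (hpos x).ne] at hy
      apply hcl
      refine map_mem_closure (f := fun y : ℝ => (WithLp.toLp 2 ![x, y] : EuclideanSpace ℝ (Fin 2))) hlc hy ?_
      intro z hz
      have : (x, z) ∈ auxE ⁻¹' Pi := by rw [hpre]; exact ⟨hx, hz⟩
      exact this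
    have hder : ∀ y ∈ Set.uIcc 0 (h x), HasDerivAt (fun y => u (WithLp.toLp 2 ![x, y]))
        (fderiv ℝ u (WithLp.toLp 2 ![x, y]) e) y := by
      intro y hy
      have hd : DifferentiableAt ℝ u (WithLp.toLp 2 ![x, y]) :=
        (hu.differentiableOn one_ne_zero).differentiableAt (hU.mem_nhds (hmem y hy))
      exact hd.hasFDerivAt.comp_hasDerivAt y (aux_line x y)
    have hci : IntervalIntegrable (fun y => fderiv ℝ u (WithLp.toLp 2 ![x, y]) e) volume 0 (h x) :=
      ContinuousOn.intervalIntegrable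
        ((hfd.comp hlc.continuousOn hmem).clm_apply continuousOn_const)
    have ftc := intervalIntegral.integral_eq_sub_of_hasDerivAt hder hci
    have b0 : u (WithLp.toLp 2 ![x, 0]) = 0 := h0 x (Set.Ioo_subset_Icc_self hx)
    have b1 : u (WithLp.toLp 2 ![x, h x]) = 1 := h1 x (Set.Ioo_subset_Icc_self hx)
    rw [b0, b1, sub_zero] at ftc
    have e2 : ∀ y, G (WithLp.toLp 2 ![x, y]) = (1 - p) * h x ^ (-p) +
        p * h x ^ (1 - p) * fderiv ℝ u (WithLp.toLp 2 ![x, y]) e := fun y => rfl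
    simp only [e2]
    rw [intervalIntegral.integral_add intervalIntegrable_const (hci.const_mul _),
      intervalIntegral.integral_const, intervalIntegral.integral_const_mul, ftc]
    have h2 : h x ^ (1 - p) = h x * h x ^ (-p) := by
      rw [sub_eq_add_neg, Real.rpow_add (hpos x), Real.rpow_one]
    change h x ^ (1 - p) = _
    rw [h2, smul_eq_mul]
    ring
  · rw [Set.indicator_of_notMem hx]
    symm
    apply integral_eq_zero_of_ae
    refine Filter.Eventually.of_forall fun y => ?_
    apply Set.indicator_of_notMem
    rw [hpre]
    exact fun H => hx H.1
end
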